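/- arXiv:2005.03757 — 6 statements merged into one kernel-verified Lean document; each statement's English description precedes it below -/
import Mathlib

section
/- Let G be a finite group and let π be a set of primes. If every element of vcs(G) is divisible only by primes in π, then G = NH, where N is a normal Hall π-subgroup of G and H is an abelian π-complement of G. -/
open scoped Classical

noncomputable section

/-- `g` is a vanishing element of `G`: some irreducible complex character of `G`
takes the value `0` at `g`. -/
def IsVanishing (G : Type) [Group G] (g : G) : Prop :=
  ∃ V : FDRep ℂ G, CategoryTheory.Simple V ∧ V.character g = 0

/-- The conjugacy class size of `g`, i.e. `|G : C_G(g)|`. -/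
def classSize {G : Type*} [Group G] (g : G) : ℕ := (Subgroup.centralizer {g}).index

/-- The set of conjugacy class sizes of vanishing elements of `G`. -/
def vcs (G : Type) [Group G] : Set ℕ :=
  {n | ∃ g : G, IsVanishing G g ∧ classSize g = n}

/-- The set of conjugacy class sizes of `G`. -/
def cs (G : Type*) [Group G] : Set ℕ := {n | ∃ g : G, classSize g = n}

/-- `H` is a Hall `π`-subgroup of `G`. -/
def IsHallSubgroup {G : Type*} [Group G] (π : Set ℕ) (H : Subgroup G) : Prop :=
  (∀ p : ℕ, p.Prime → p ∣ Nat.card H → p ∈ π) ∧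
  (∀ p : ℕ, p.Prime → p ∣ H.index → p ∉ π)

/-- The set of prime divisors of `n`. -/
def primesOf (n : ℕ) : Set ℕ := {p | p.Prime ∧ p ∣ n}

/-- The `π`-part `n_π` of `n`: the largest divisor of `n` all of whose prime
factors lie in `π`. -/
noncomputable def piPart (π : Set ℕ) (n : ℕ) : ℕ :=
  ∏ p ∈ n.primeFactors, p ^ (if p ∈ π then n.factorization p else 0)

/-- The subgroup `H` is abelian. -/
def IsAbelianSubgroup {G : Type*} [Group G] (H : Subgroup G) : Prop :=
  ∀ a ∈ H, ∀ b ∈ H, a * b = b * a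

/-- `X` is a Frobenius group with kernel `K`: `K` is a nontrivial proper normal
subgroup and the centralizer of every nontrivial element of `K` lies in `K`. -/
def IsFrobeniusWithKernel {X : Type*} [Group X] (K : Subgroup X) : Prop :=
  K ≠ ⊥ ∧ K ≠ ⊤ ∧ K.Normal ∧ ∀ k ∈ K, k ≠ 1 → Subgroup.centralizer {k} ≤ K

/-- `X` is a Frobenius group with kernel `K` and complement `C`. -/
def IsFrobenius {X : Type*} [Group X] (K C : Subgroup X) : Prop :=
  IsFrobeniusWithKernel K ∧ K ⊔ C = ⊤ ∧ K ⊓ C = ⊥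

/-- `G` is supersolvable: there is a chain of subgroups from `⊥` to `⊤`, each
normal in `G`, with all successive quotients cyclic (equivalently, each term is
generated by the previous one together with a single element). -/
def IsSupersolvable (G : Type*) [Group G] : Prop :=
  ∃ (n : ℕ) (c : Fin (n + 1) → Subgroup G),
    c 0 = ⊥ ∧ c (Fin.last n) = ⊤ ∧
    (∀ i : Fin n, c i.castSucc ≤ c i.succ) ∧
    (∀ i : Fin (n + 1), (c i).Normal) ∧
    (∀ i : Fin n, ∃ g : G, c i.castSucc ⊔ Subgroup.zpowers g = c i.succ)

/-- The Fitting subgroup of `G`: the subgroup generated by all nilpotent normal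
subgroups of `G`. -/
def Fitting (G : Type*) [Group G] : Subgroup G :=
  ⨆ H ∈ {H : Subgroup G | H.Normal ∧ Group.IsNilpotent ↥H}, H

/-- `O_p(G)`: the subgroup generated by all normal `p`-subgroups of `G`
(the largest normal `p`-subgroup). -/
def pCore' (p : ℕ) (G : Type*) [Group G] : Subgroup G :=
  ⨆ K ∈ {K : Subgroup G | K.Normal ∧ IsPGroup p ↥K}, K


/-- The trace of a complex idempotent matrix is a natural number. -/
theorem exists_natCast_eq_trace_of_isIdempotentElem {ι : Type*} [Fintype ι] [DecidableEq ι]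
    {E : Matrix ι ι ℂ} (hE : IsIdempotentElem E) : ∃ m : ℕ, E.trace = m := by
  have h : IsIdempotentElem (Matrix.toLin' E) := hE.map Matrix.toLinAlgEquiv'
  exact ⟨_, by
    rw [← Matrix.trace_toLin'_eq]
    exact (LinearMap.IsIdempotentElem.isProj_range _ h).trace⟩

/-- The traces of the powers of a complex matrix of finite order, in terms of the multiplicities
of its eigenvalues. -/
theorem exists_trace_pow_eq_sum {ι : Type*} [Fintype ι] [DecidableEq ι]
    {A : Matrix ι ι ℂ} {n : ℕ} (hn : n ≠ 0) (hA : A ^ n = 1) {ζ : ℂ} (hζ : IsPrimitiveRoot ζ n) :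
    ∃ m : ℕ → ℕ, ∀ k, (A ^ k).trace = ∑ j ∈ Finset.range n, (m j : ℂ) * ζ ^ (j * k) := by
  have hζ0 : ζ ≠ 0 := hζ.ne_zero hn
  have hn' : (n : ℂ) ≠ 0 := Nat.cast_ne_zero.mpr hn
  let E : ℕ → Matrix ι ι ℂ := fun j ↦ (n : ℂ)⁻¹ • ∑ l ∈ Finset.range n, (ζ⁻¹ ^ j) ^ l • A ^ l
  have hEA (j : ℕ) : E j * A = ζ ^ j • E j := by
    have h1 : ζ⁻¹ ^ j • ((∑ l ∈ Finset.range n, (ζ⁻¹ ^ j) ^ l • A ^ l) * A) =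
        ∑ l ∈ Finset.range n, (ζ⁻¹ ^ j) ^ (l + 1) • A ^ (l + 1) := by
      simp only [Finset.smul_sum, Finset.sum_mul, pow_succ, smul_smul, smul_mul_assoc]
      exact Finset.sum_congr rfl fun l _ ↦ by rw [mul_comm]
    have h2 : ∑ l ∈ Finset.range n, (ζ⁻¹ ^ j) ^ (l + 1) • A ^ (l + 1) =
        ∑ l ∈ Finset.range n, (ζ⁻¹ ^ j) ^ l • A ^ l := by
      have := (Finset.sum_range_succ (fun l ↦ (ζ⁻¹ ^ j) ^ l • A ^ l) n).symm.trans
        (Finset.sum_range_succ' (fun l ↦ (ζ⁻¹ ^ j) ^ l • A ^ l) n)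
      have hz : (ζ⁻¹ ^ j) ^ n = 1 := by
        rw [← pow_mul, mul_comm, pow_mul, inv_pow, hζ.pow_eq_one, inv_one, one_pow]
      rw [hz, hA, pow_zero, pow_zero] at this
      exact (add_right_cancel this).symm
    have h3 : (∑ l ∈ Finset.range n, (ζ⁻¹ ^ j) ^ l • A ^ l) * A =
        ζ ^ j • ∑ l ∈ Finset.range n, (ζ⁻¹ ^ j) ^ l • A ^ l := by
      conv_rhs => rw [← h2, ← h1]
      rw [smul_smul, ← mul_pow, mul_inv_cancel₀ hζ0, one_pow, one_smul]
    simp only [E, smul_mul_assoc, h3]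
    rw [smul_comm]
  have hEA' (j k : ℕ) : E j * A ^ k = ζ ^ (j * k) • E j := by
    induction k with
    | zero => simp
    | succ k ih => rw [pow_succ, ← mul_assoc, ih, smul_mul_assoc, hEA, smul_smul, ← pow_add]; rfl
  have hE (j : ℕ) : IsIdempotentElem (E j) := by
    have : E j * E j = (n : ℂ)⁻¹ • ∑ l ∈ Finset.range n, (ζ⁻¹ ^ j) ^ l • (E j * A ^ l) := by
      conv_lhs => rhs; simp only [E]
      simp only [mul_smul_comm, Finset.mul_sum]
    rw [IsIdempotentElem, this]
    have (l : ℕ) : (ζ⁻¹ ^ j) ^ l • (E j * A ^ l) = E j := by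
      rw [hEA', smul_smul, pow_mul, ← mul_pow, ← mul_pow, inv_mul_cancel₀ hζ0, one_pow, one_pow,
        one_smul]
    simp only [this, Finset.sum_const, Finset.card_range]
    rw [← Nat.cast_smul_eq_nsmul ℂ, smul_smul, inv_mul_cancel₀ hn', one_smul]
  have hsum : ∑ j ∈ Finset.range n, E j = 1 := by
    simp only [E, ← Finset.smul_sum]
    rw [Finset.sum_comm]
    have (l : ℕ) (hl : l ∈ Finset.range n) :
        ∑ j ∈ Finset.range n, (ζ⁻¹ ^ j) ^ l • A ^ l = if l = 0 then (n : ℂ) • 1 else 0 := by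
      rw [← Finset.sum_smul]
      split_ifs with h
      · simp [h]
      · have hne : ζ⁻¹ ^ l ≠ 1 :=
          hζ.inv.pow_ne_one_of_pos_of_lt h (Finset.mem_range.mp hl)
        have hg := mul_geom_sum (ζ⁻¹ ^ l) n
        rw [← pow_mul, mul_comm l, pow_mul, hζ.inv.pow_eq_one, one_pow, sub_self, mul_eq_zero,
          sub_eq_zero] at hg
        have := hg.resolve_left hne
        simp_rw [← pow_mul, mul_comm l, pow_mul] at this
        rw [this, zero_smul]
    rw [Finset.sum_congr rfl this, Finset.sum_ite_eq' _ 0,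
      if_pos (Finset.mem_range.mpr (Nat.pos_of_ne_zero hn)), smul_smul, inv_mul_cancel₀ hn',
      one_smul]
  choose m hm using fun j ↦ exists_natCast_eq_trace_of_isIdempotentElem (hE j)
  refine ⟨m, fun k ↦ ?_⟩
  rw [← one_mul (A ^ k), ← hsum, Finset.sum_mul, Matrix.trace_sum]
  exact Finset.sum_congr rfl fun j _ ↦ by rw [hEA', Matrix.trace_smul, hm, smul_eq_mul, mul_comm]

section Character

variable {G : Type} [Group G] {ι : Type} [Fintype ι] [DecidableEq ι]

theorem trace_map_inv [Finite G] (ρ : G →* Matrix ι ι ℂ) (g : G) :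
    (ρ g⁻¹).trace = (starRingEnd ℂ) (ρ g).trace := by
  have hn : Nat.card G ≠ 0 := Nat.card_pos.ne'
  have hζ := Complex.isPrimitiveRoot_exp _ hn
  set ζ := Complex.exp (2 * Real.pi * Complex.I / (Nat.card G : ℕ))
  have hA : ρ g ^ Nat.card G = 1 := by rw [← map_pow, pow_card_eq_one', map_one]
  obtain ⟨m, hm⟩ := exists_trace_pow_eq_sum hn hA hζ
  have hinv : g⁻¹ = g ^ (Nat.card G - 1) := by
    rw [inv_eq_iff_mul_eq_one, ← pow_succ', Nat.sub_add_cancel (Nat.pos_of_ne_zero hn),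
      pow_card_eq_one']
  have hconj : (starRingEnd ℂ) ζ = ζ ^ (Nat.card G - 1) := by
    rw [← Complex.inv_eq_conj (hζ.norm'_eq_one hn), inv_eq_iff_eq_inv, eq_comm, inv_eq_iff_eq_inv,
      ← mul_eq_one_iff_eq_inv₀ (hζ.ne_zero hn), ← pow_succ,
      Nat.sub_add_cancel (Nat.pos_of_ne_zero hn), hζ.pow_eq_one]
  have h1 := hm 1
  rw [pow_one] at h1
  rw [hinv, map_pow, hm, h1, map_sum]
  refine Finset.sum_congr rfl fun j _ ↦ ?_
  rw [map_mul, map_pow, hconj, ← pow_mul, Complex.conj_natCast, mul_one, mul_comm j]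

/-- The product of the values of a character at the nontrivial elements of the group is a
rational integer. -/
theorem exists_intCast_eq_prod_trace [Fintype G] (ρ : G →* Matrix ι ι ℂ) :
    ∃ P : ℤ, ∏ g ∈ Finset.univ.erase (1 : G), (ρ g).trace = P := by
  have hn : Nat.card G ≠ 0 := Nat.card_pos.ne'
  have : NeZero (Nat.card G) := ⟨hn⟩
  obtain ⟨K, _, _, _⟩ : ∃ (K : Type) (_ : Field K) (_ : Algebra ℚ K),
      IsCyclotomicExtension {Nat.card G} ℚ K :=
    ⟨CyclotomicField (Nat.card G) ℚ, inferInstance, inferInstance,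
      CyclotomicField.isCyclotomicExtension _ _⟩
  have : CharZero K := algebraRat.charZero K
  have hζ : IsPrimitiveRoot (IsCyclotomicExtension.zeta (Nat.card G) ℚ K) (Nat.card G) :=
    IsCyclotomicExtension.zeta_spec _ _ _
  have : IsGalois ℚ K := IsCyclotomicExtension.isGalois {Nat.card G} ℚ K
  have : FiniteDimensional ℚ K := IsCyclotomicExtension.finiteDimensional {Nat.card G} ℚ K
  set ζ := IsCyclotomicExtension.zeta (Nat.card G) ℚ K
  let φ : K →ₐ[ℚ] ℂ := IsAlgClosed.lift
  have hφ : Function.Injective φ := φ.toRingHom.injective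
  have key (g : G) := exists_trace_pow_eq_sum hn
    (show ρ g ^ Nat.card G = 1 by rw [← map_pow, pow_card_eq_one', map_one])
    (hζ.map_of_injective hφ)
  choose m hm using key
  let X : G → K := fun g ↦ ∑ j ∈ Finset.range (Nat.card G), (m g j : K) * ζ ^ j
  have hX (g : G) : φ (X g) = (ρ g).trace := by
    have := hm g 1
    rw [pow_one] at this
    simp [X, this]
  have hint : IsIntegral ℤ (∏ g ∈ Finset.univ.erase (1 : G), X g) :=
    .prod _ fun g _ ↦ .sum _ fun j _ ↦
      .mul (by exact_mod_cast isIntegral_algebraMap (R := ℤ) (A := K) (x := (m g j : ℤ)))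
        ((hζ.isIntegral (Nat.pos_of_ne_zero hn)).pow j)
  have hfix : ∏ g ∈ Finset.univ.erase (1 : G), X g ∈ (⊥ : IntermediateField ℚ K) := by
    refine (IsGalois.mem_bot_iff_fixed _).mpr fun σ ↦ ?_
    have hσ := hζ.autToPow_spec ℚ σ
    set k := ((hζ.autToPow ℚ σ : (ZMod (Nat.card G))ˣ) : ZMod (Nat.card G)).val
    have hk : (Nat.card G).Coprime k := (ZMod.val_coe_unit_coprime _).symm
    have hσX (g : G) : σ (X g) = X (g ^ k) := by
      apply hφ
      rw [hX, map_pow, hm]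
      simp [X, ← hσ, ← pow_mul, mul_comm]
    rw [map_prod]
    refine Finset.prod_nbij' (fun g ↦ powCoprime hk g) (fun g ↦ (powCoprime hk).symm g)
      ?_ ?_ (fun g _ ↦ Equiv.symm_apply_apply _ g) (fun g _ ↦ Equiv.apply_symm_apply _ g)
      fun g _ ↦ hσX g
    · intro g hg
      simp only [Finset.mem_erase, Finset.mem_univ, and_true] at hg ⊢
      rwa [Ne, ← powCoprime_one hk, (powCoprime hk).injective.eq_iff]
    · intro g hg
      simp only [Finset.mem_erase, Finset.mem_univ, and_true] at hg ⊢
      rwa [Ne, Equiv.symm_apply_eq, powCoprime_one]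
  obtain ⟨q, hq⟩ := IntermediateField.mem_bot.mp hfix
  rw [← hq, isIntegral_algebraMap_iff (algebraMap ℚ K).injective,
    IsIntegrallyClosed.isIntegral_iff] at hint
  obtain ⟨P, rfl⟩ := hint
  refine ⟨P, ?_⟩
  rw [← Finset.prod_congr rfl fun g _ ↦ hX g, ← map_prod, ← hq]
  simp

/-- The representation on column vectors afforded by a matrix representation. -/
abbrev matrixRepresentation (ρ : G →* Matrix ι ι ℂ) : Representation ℂ G (ι → ℂ) :=
  (Matrix.toLinAlgEquiv' (R := ℂ) (n := ι)).toAlgHom.toRingHom.toMonoidHom.comp ρ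

theorem character_matrixRepresentation (ρ : G →* Matrix ι ι ℂ) (g : G) :
    (matrixRepresentation ρ).character g = (ρ g).trace :=
  Matrix.trace_toLin'_eq _

theorem isIrreducible_matrixRepresentation [Nonempty ι] {ρ : G →* Matrix ι ι ℂ}
    (hρ : Function.Surjective (MonoidAlgebra.lift ℂ (Matrix ι ι ℂ) G ρ)) :
    (matrixRepresentation ρ).IsIrreducible := by
  have hstable (W : Subrepresentation (matrixRepresentation ρ)) (M : Matrix ι ι ℂ) {v : ι → ℂ}
      (hv : v ∈ W.toSubmodule) : M.mulVec v ∈ W.toSubmodule := by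
    obtain ⟨a, rfl⟩ := hρ M
    induction a using MonoidAlgebra.induction_on with
    | of g => simpa using W.apply_mem_toSubmodule g hv
    | add a b ha hb => rw [map_add, Matrix.add_mulVec]; exact add_mem ha hb
    | smul r a ha => rw [map_smul, Matrix.smul_mulVec]; exact W.toSubmodule.smul_mem _ ha
  have : Nontrivial (Subrepresentation (matrixRepresentation ρ)) := by
    refine ⟨⊥, ⊤, fun h ↦ ?_⟩
    have := congrArg Subrepresentation.toSubmodule h
    exact bot_ne_top (α := Submodule ℂ (ι → ℂ)) this
  refine ⟨fun W ↦ or_iff_not_imp_left.mpr fun hW ↦ ?_⟩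
  have hW' : W.toSubmodule ≠ ⊥ := fun h ↦ hW (Subrepresentation.toSubmodule_injective h)
  obtain ⟨v, hv, hv0⟩ := Submodule.exists_mem_ne_zero_of_ne_bot hW'
  obtain ⟨i, hi⟩ := Function.ne_iff.mp hv0
  refine Subrepresentation.toSubmodule_injective (eq_top_iff.mpr fun w _ ↦ ?_)
  convert hstable W (Matrix.vecMulVec w (Pi.single i (v i)⁻¹)) hv
  ext j
  simp only [Pi.zero_apply, ne_eq] at hi
  simp [Matrix.vecMulVec_mulVec, hi]

theorem sum_trace_mul_trace_inv [Fintype G] [Nonempty ι] {ρ : G →* Matrix ι ι ℂ}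
    (hρ : Function.Surjective (MonoidAlgebra.lift ℂ (Matrix ι ι ℂ) G ρ)) :
    ∑ g : G, (ρ g).trace * (ρ g⁻¹).trace = Nat.card G := by
  have := isIrreducible_matrixRepresentation hρ
  have hG : (Nat.card G : ℂ) ≠ 0 := Nat.cast_ne_zero.mpr Nat.card_pos.ne'
  have := invertibleOfNonzero hG
  have h := (matrixRepresentation ρ).char_orthonormal (matrixRepresentation ρ)
  rw [if_pos ⟨.refl _⟩, inv_mul_eq_one₀ hG] at h
  simp only [h, character_matrixRepresentation]

theorem simple_matrixRepresentation [Finite G] [Nonempty ι] {ρ : G →* Matrix ι ι ℂ}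
    (hρ : Function.Surjective (MonoidAlgebra.lift ℂ (Matrix ι ι ℂ) G ρ)) :
    CategoryTheory.Simple (FDRep.of (matrixRepresentation ρ)) := by
  cases nonempty_fintype G
  rw [FDRep.simple_iff_char_is_norm_one, ← sum_trace_mul_trace_inv hρ]
  exact Finset.sum_congr rfl fun g _ ↦ congrArg₂ _
    (character_matrixRepresentation ρ g) (character_matrixRepresentation ρ g⁻¹)

/-- **Burnside's theorem**: a nonlinear irreducible character of a finite group vanishes at some
element. -/
theorem exists_trace_eq_zero [Finite G] [Nontrivial ι] {ρ : G →* Matrix ι ι ℂ}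
    (hρ : Function.Surjective (MonoidAlgebra.lift ℂ (Matrix ι ι ℂ) G ρ)) :
    ∃ g, (ρ g).trace = 0 := by
  cases nonempty_fintype G
  by_contra! h
  have hsum : ∑ g : G, ‖(ρ g).trace‖ ^ 2 = Fintype.card G := by
    have := sum_trace_mul_trace_inv hρ
    simp only [trace_map_inv, Complex.mul_conj'] at this
    rw [Nat.card_eq_fintype_card] at this
    exact_mod_cast this
  obtain ⟨P, hP⟩ := exists_intCast_eq_prod_trace ρ
  have hP0 : P ≠ 0 := by
    rintro rfl
    rw [Int.cast_zero, Finset.prod_eq_zero_iff] at hP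
    obtain ⟨g, _, hg⟩ := hP
    exact h g hg
  have hlog : 0 ≤ ∑ g ∈ Finset.univ.erase (1 : G), Real.log (‖(ρ g).trace‖ ^ 2) := by
    rw [← Real.log_prod fun g _ ↦ pow_ne_zero _ (norm_ne_zero_iff.mpr (h g)), Finset.prod_pow,
      ← norm_prod, hP]
    refine Real.log_nonneg (one_le_pow₀ ?_)
    rw [Complex.norm_intCast]
    exact_mod_cast Int.one_le_abs hP0
  have hle : ∑ g ∈ Finset.univ.erase (1 : G), Real.log (‖(ρ g).trace‖ ^ 2) ≤
      ∑ g ∈ Finset.univ.erase (1 : G), (‖(ρ g).trace‖ ^ 2 - 1) :=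
    Finset.sum_le_sum fun g _ ↦ Real.log_le_sub_one_of_pos
      (pow_pos (norm_pos_iff.mpr (h g)) 2)
  have hone : (∑ g ∈ Finset.univ.erase (1 : G), (‖(ρ g).trace‖ ^ 2 - 1)) +
      (‖(ρ 1).trace‖ ^ 2 - 1) = 0 := by
    rw [Finset.sum_erase_add _ _ (Finset.mem_univ _), Finset.sum_sub_distrib, hsum]
    simp
  rw [map_one, Matrix.trace_one, Complex.norm_natCast] at hone
  have hcard : (1 : ℝ) < Fintype.card ι := by exact_mod_cast Fintype.one_lt_card
  nlinarith

end Character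

/-- The sum of the conjugates of `g` in the group ring. -/
def conjSum (R : Type*) [Semiring R] {G : Type*} [Group G] [Fintype G] (g : G) :
    MonoidAlgebra R G :=
  ∑ h ∈ Finset.univ.filter (IsConj g), MonoidAlgebra.single h 1

theorem card_filter_isConj {G : Type*} [Group G] [Fintype G] (g : G) :
    (Finset.univ.filter (IsConj g)).card = classSize g := by
  have h : (Finset.univ.filter (IsConj g)).card = (MulAction.orbit (ConjAct G) g).ncard := by
    rw [← Set.ncard_coe_finset]
    congr 1
    ext h
    simpa [ConjAct.mem_orbit_conjAct, -isConj_iff] using isConj_comm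
  rw [h, ← MulAction.index_stabilizer, classSize, ConjAct.stabilizer_eq_centralizer]
  rfl

theorem single_mul_conjSum {R : Type*} [CommSemiring R] {G : Type*} [Group G] [Fintype G]
    (g x : G) :
    MonoidAlgebra.single x 1 * conjSum R g = conjSum R g * MonoidAlgebra.single x 1 := by
  simp only [conjSum, Finset.mul_sum, Finset.sum_mul, MonoidAlgebra.single_mul_single, mul_one]
  refine Finset.sum_nbij' (fun h ↦ x * h * x⁻¹) (fun h ↦ x⁻¹ * h * x) ?_ ?_ ?_ ?_ ?_
  · intro h hh
    simp only [Finset.mem_filter, Finset.mem_univ, true_and] at hh ⊢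
    exact hh.trans (isConj_iff.mpr ⟨x, rfl⟩)
  · intro h hh
    simp only [Finset.mem_filter, Finset.mem_univ, true_and] at hh ⊢
    exact hh.trans (isConj_iff.mpr ⟨x⁻¹, by simp⟩)
  all_goals intros; simp [mul_assoc]

/-- If an irreducible character vanishes at `g`, then the class sum of `g` acts as zero. -/
theorem lift_conjSum_eq_zero {G : Type} [Group G] [Fintype G] {ι : Type} [Fintype ι]
    [DecidableEq ι] [Nonempty ι] {ρ : G →* Matrix ι ι ℂ}
    (hρ : Function.Surjective (MonoidAlgebra.lift ℂ (Matrix ι ι ℂ) G ρ))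
    {g : G} (hg : (ρ g).trace = 0) :
    MonoidAlgebra.lift ℂ (Matrix ι ι ℂ) G ρ (conjSum ℂ g) = 0 := by
  have hcentral (a : MonoidAlgebra ℂ G) : Commute a (conjSum ℂ g) := by
    induction a using MonoidAlgebra.induction_on with
    | of x => exact single_mul_conjSum g x
    | add a b ha hb => exact ha.add_left hb
    | smul r a ha => exact ha.smul_left r
  obtain ⟨c, hc⟩ := Matrix.mem_range_scalar_of_commute_single
    (M := MonoidAlgebra.lift ℂ (Matrix ι ι ℂ) G ρ (conjSum ℂ g)) fun i j _ ↦ by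
      obtain ⟨a, ha⟩ := hρ (Matrix.single i j 1)
      rw [← ha]
      exact (hcentral a).map _
  have htr : (MonoidAlgebra.lift ℂ (Matrix ι ι ℂ) G ρ (conjSum ℂ g)).trace = 0 := by
    rw [conjSum, map_sum, Matrix.trace_sum]
    refine Finset.sum_eq_zero fun h hh ↦ ?_
    obtain ⟨x, rfl⟩ := isConj_iff.mp (Finset.mem_filter.mp hh).2
    rw [MonoidAlgebra.lift_single, one_smul, map_mul, map_mul, Matrix.trace_mul_cycle, ← map_mul,
      inv_mul_cancel, map_one, one_mul, hg]
  rw [← hc] at htr ⊢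
  simp only [Matrix.scalar_apply, Matrix.trace_diagonal, Finset.sum_const, Finset.card_univ,
    nsmul_eq_mul, mul_eq_zero, Nat.cast_eq_zero, Fintype.card_ne_zero, false_or] at htr
  rw [htr, map_zero]

/-- If an element `z` of the integral group ring is fixed by right multiplication by the elements
of a subgroup `N`, then `|N|` divides the augmentation of `z`. -/
theorem card_dvd_augmentation {G : Type*} [Group G] [Finite G] (N : Subgroup G)
    (z : MonoidAlgebra ℤ G) (hz : ∀ n ∈ N, z * MonoidAlgebra.single n 1 = z) :
    (Nat.card N : ℤ) ∣ MonoidAlgebra.lift ℤ ℤ G 1 z := by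
  cases nonempty_fintype G
  have hcoeff (g : G) (n : N) : z.coeff (g * n) = z.coeff g := by
    conv_lhs => rw [← hz n n.2]
    simp
  have haug : MonoidAlgebra.lift ℤ ℤ G 1 z = ∑ g, z.coeff g := by
    rw [MonoidAlgebra.lift_apply, Finsupp.sum_fintype _ _ (by simp)]
    simp
  obtain ⟨T, hT, -⟩ := N.exists_isComplement_left 1
  rw [haug, ← hT.sum_comp, Fintype.sum_prod_type]
  exact Finset.dvd_sum fun t _ ↦ ⟨z.coeff t, by simp [hcoeff]⟩

/-- A prime divisor of the order of the commutator subgroup divides the size of a vanishing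
conjugacy class. -/
theorem exists_mem_vcs_of_dvd_card_commutator (G : Type) [Group G] [Finite G] {p : ℕ}
    (hp : p.Prime) (hpG : p ∣ Nat.card (commutator G)) : ∃ n ∈ vcs G, p ∣ n := by
  cases nonempty_fintype G
  by_contra! hvcs
  obtain ⟨n, d, hd, ⟨Φ⟩⟩ :=
    IsSemisimpleRing.exists_algEquiv_pi_matrix_of_isAlgClosed ℂ (MonoidAlgebra ℂ G)
  let ρ (i : Fin n) : G →* Matrix (Fin (d i)) (Fin (d i)) ℂ :=
    (MonoidAlgebra.lift ℂ _ G).symm ((Pi.evalAlgHom ℂ _ i).comp Φ.toAlgHom)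
  have hlift (i : Fin n) (a : MonoidAlgebra ℂ G) : MonoidAlgebra.lift ℂ _ G (ρ i) a = Φ a i := by
    simp only [ρ, Equiv.apply_symm_apply]
    rfl
  have hρ (i : Fin n) : Function.Surjective (MonoidAlgebra.lift ℂ _ G (ρ i)) := fun M ↦ by
    obtain ⟨a, ha⟩ := Φ.surjective (Pi.single i M)
    exact ⟨a, by rw [hlift, ha, Pi.single_eq_same]⟩
  let f : MonoidAlgebra ℤ G →+* MonoidAlgebra ℂ G :=
    MonoidAlgebra.mapRingHom G (Int.castRingHom ℂ)
  have hf : Function.Injective f :=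
    MonoidAlgebra.map_injective (Int.castAddHom ℂ) Int.cast_injective
  have hfac (i : Fin n) (hi : d i ≠ 1) :
      ∃ y : MonoidAlgebra ℤ G, Φ (f y) i = 0 ∧ ¬ (p : ℤ) ∣ MonoidAlgebra.lift ℤ ℤ G 1 y := by
    have : Nontrivial (Fin (d i)) := Fin.nontrivial_iff_two_le.mpr (by have := (hd i).ne; omega)
    obtain ⟨g, hg⟩ := exists_trace_eq_zero (hρ i)
    refine ⟨conjSum ℤ g, ?_, ?_⟩
    · rw [← hlift, ← lift_conjSum_eq_zero (hρ i) hg]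
      simp [f, conjSum]
    · have haug : MonoidAlgebra.lift ℤ ℤ G 1 (conjSum ℤ g) = classSize g := by
        simp [conjSum, ← card_filter_isConj]
      rw [haug, Int.natCast_dvd_natCast]
      exact hvcs _ ⟨g, ⟨_, simple_matrixRepresentation (hρ i),
        (character_matrixRepresentation (ρ i) g).trans hg⟩, rfl⟩
  obtain ⟨z, hz, hpz⟩ : ∃ z : MonoidAlgebra ℤ G,
      (∀ i, d i ≠ 1 → Φ (f z) i = 0) ∧ ¬ (p : ℤ) ∣ MonoidAlgebra.lift ℤ ℤ G 1 z := by
    suffices h : ∀ s : Finset (Fin n), ∃ z : MonoidAlgebra ℤ G,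
        (∀ i ∈ s, d i ≠ 1 → Φ (f z) i = 0) ∧ ¬ (p : ℤ) ∣ MonoidAlgebra.lift ℤ ℤ G 1 z by
      simpa using h Finset.univ
    intro s
    induction s using Finset.induction_on with
    | empty => exact ⟨1, by simp, by simpa using (Nat.prime_iff_prime_int.mp hp).not_dvd_one⟩
    | insert i s _ ih =>
      obtain ⟨z, hz, hpz⟩ := ih
      by_cases hi : d i = 1
      · exact ⟨z, by simpa [hi] using hz, hpz⟩
      · obtain ⟨y, hy, hpy⟩ := hfac i hi
        refine ⟨z * y, fun j hj hdj ↦ ?_, ?_⟩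
        · rw [map_mul, map_mul, Pi.mul_apply]
          rcases Finset.mem_insert.mp hj with rfl | hj
          · rw [hy, mul_zero]
          · rw [hz j hj hdj, zero_mul]
        · rw [map_mul, (Nat.prime_iff_prime_int.mp hp).dvd_mul]
          exact not_or.mpr ⟨hpz, hpy⟩
  have hlinear (i : Fin n) (hi : d i = 1) : commutator G ≤ (ρ i).ker := by
    have : Subsingleton (Fin (d i)) := by rw [hi]; infer_instance
    rw [commutator_def, Subgroup.commutator_le]
    intro a _ b _
    have hcomm : ρ i a * ρ i b = ρ i b * ρ i a := by
      ext j k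
      rw [Subsingleton.elim k j]
      simp [Matrix.mul_apply, Fintype.sum_subsingleton _ j, mul_comm]
    rw [MonoidHom.mem_ker, commutatorElement_def, map_mul, map_mul, map_mul, hcomm,
      ← map_mul, ← map_mul, ← map_mul]
    simp
  refine hpz ((Int.natCast_dvd_natCast.mpr hpG).trans (card_dvd_augmentation _ z fun x hx ↦ ?_))
  apply hf
  apply Φ.injective
  ext1 i
  by_cases hi : d i = 1
  · have hx' : Φ (f (MonoidAlgebra.single x 1)) i = 1 := by
      rw [← hlift, ← MonoidHom.mem_ker.mp (hlinear i hi hx)]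
      simp [f]
    rw [map_mul, map_mul, Pi.mul_apply, hx', mul_one]
  · rw [map_mul, map_mul, Pi.mul_apply, hz i hi, zero_mul]

/-- The elements of a finite commutative group whose order is divisible only by primes in `π`. -/
def piTorsion (π : Set ℕ) (A : Type*) [CommGroup A] [Finite A] : Subgroup A where
  carrier := {a | ∀ p : ℕ, p.Prime → p ∣ orderOf a → p ∈ π}
  one_mem' p hp h := (hp.one_lt.ne' (by simpa using h)).elim
  mul_mem' {a b} ha hb p hp h := by
    have := (h.trans (Commute.all a b).orderOf_mul_dvd_lcm).trans (Nat.lcm_dvd_mul _ _)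
    exact (hp.dvd_mul.mp this).elim (ha p hp) (hb p hp)
  inv_mem' {a} ha p hp h := ha p hp (by rwa [orderOf_inv] at h)

theorem isHallSubgroup_piTorsion (π : Set ℕ) (A : Type*) [CommGroup A] [Finite A] :
    IsHallSubgroup π (piTorsion π A) := by
  refine ⟨fun p hp h ↦ ?_, fun p hp h hpπ ↦ ?_⟩
  · have := Fact.mk hp
    obtain ⟨x, hx⟩ := exists_prime_orderOf_dvd_card' p h
    exact x.2 p hp (by rw [Subgroup.orderOf_coe, hx])
  · have := Fact.mk hp
    obtain ⟨x, hx⟩ := exists_prime_orderOf_dvd_card' (G := A ⧸ piTorsion π A) p h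
    obtain ⟨a, rfl⟩ := QuotientGroup.mk_surjective x
    have hap : a ^ p ∈ piTorsion π A := by
      rw [← QuotientGroup.eq_one_iff, QuotientGroup.mk_pow, ← hx, pow_orderOf_eq_one]
    have ha : a ∈ piTorsion π A := fun q hq hqa ↦ by
      have hdvd : orderOf a ∣ p * orderOf (a ^ p) :=
        orderOf_dvd_of_pow_eq_one (by rw [pow_mul, pow_orderOf_eq_one])
      rcases hq.dvd_mul.mp (hqa.trans hdvd) with h | h
      · rwa [(Nat.prime_dvd_prime_iff_eq hq hp).mp h]
      · exact hap q hq h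
    rw [(QuotientGroup.eq_one_iff a).mpr ha, orderOf_one] at hx
    exact hp.one_lt.ne hx

/-- Lemma 2.1(a): if every vanishing class size of `G` is divisible only by
primes in `π`, then `G = NH` with `N` a normal Hall `π`-subgroup and `H` an
abelian `π`-complement. -/
theorem statement2 (G : Type) [Group G] [Finite G] (π : Set ℕ)
    (h : ∀ n ∈ vcs G, ∀ p : ℕ, p.Prime → p ∣ n → p ∈ π) :
    ∃ N H : Subgroup G, N.Normal ∧ IsHallSubgroup π N ∧
      IsHallSubgroup πᶜ H ∧ IsAbelianSubgroup H ∧ N ⊔ H = ⊤ := by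
  have hcomm (p : ℕ) (hp : p.Prime) (hpG : p ∣ Nat.card (commutator G)) : p ∈ π :=
    have ⟨n, hn, hpn⟩ := exists_mem_vcs_of_dvd_card_commutator G hp hpG
    h n hn p hp hpn
  obtain ⟨hT, hT'⟩ := isHallSubgroup_piTorsion π (Abelianization G)
  set N : Subgroup G := (piTorsion π (Abelianization G)).comap Abelianization.of with hNdef
  have hle : commutator G ≤ N := by
    rw [← Abelianization.ker_of]
    exact Subgroup.ker_le_comap _ _
  have hN : IsHallSubgroup π N := by
    refine ⟨fun p hp hpN ↦ ?_, fun p hp hpN ↦ hT' p hp ?_⟩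
    · by_contra hpπ
      have := Fact.mk hp
      obtain ⟨x, hx⟩ := exists_prime_orderOf_dvd_card' p hpN
      have hx' : orderOf (x : G) = p := by rw [Subgroup.orderOf_coe, hx]
      have hdvd : orderOf (Abelianization.of (x : G)) ∣ p := hx' ▸ orderOf_map_dvd _ _
      have hxker : (x : G) ∈ commutator G := by
        rw [← Abelianization.ker_of, MonoidHom.mem_ker, ← orderOf_eq_one_iff]
        refine ((Nat.dvd_prime hp).mp hdvd).resolve_right fun h ↦ hpπ (x.2 p hp h.symm.dvd)
      exact hpπ (hcomm p hp (hx' ▸ Subgroup.orderOf_dvd_natCard _ hxker))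
    · rwa [hNdef, Subgroup.index_comap_of_surjective _ QuotientGroup.mk_surjective] at hpN
  have hcop : (Nat.card N).Coprime N.index :=
    Nat.coprime_of_dvd fun p hp h₁ h₂ ↦ hN.2 p hp h₂ (hN.1 p hp h₁)
  obtain ⟨H, hH⟩ := Subgroup.exists_right_complement'_of_coprime hcop
  refine ⟨N, H, inferInstance, hN, ⟨fun p hp hpH ↦ hN.2 p hp ?_, fun p hp hpH ↦ ?_⟩,
    fun a ha b hb ↦ ?_, hH.sup_eq_top⟩
  · rwa [hH.symm.index_eq_card]
  · rw [hH.index_eq_card] at hpH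
    exact not_not.mpr (hN.1 p hp hpH)
  · rw [← commutatorElement_eq_one_iff_mul_comm, ← Subgroup.mem_bot, ← hH.disjoint.eq_bot]
    exact ⟨hle (Subgroup.commutator_mem_commutator (Subgroup.mem_top a) (Subgroup.mem_top b)),
      H.mul_mem (H.mul_mem (H.mul_mem ha hb) (H.inv_mem ha)) (H.inv_mem hb)⟩
end
end

section
/- Let G be a finite group and let π be a set of primes such that every element of vcs(G) is divisible only by primes in π; let N be a normal Hall π-subgroup of G and H a π-complement of G. If x ∈ N is a vanishing element of G, then x lies in C_N(H^y) for a suitable y ∈ N, where H^y denotes the conjugate of H by y. -/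
open scoped Classical

noncomputable section

/-- The traces of the powers of an operator of finite order, in terms of its eigenvalues. -/
theorem Module.End.exists_trace_pow_eq_sum {V : Type*} [AddCommGroup V] [Module ℂ V]
    [FiniteDimensional ℂ V] {n : ℕ} (hn : 0 < n) (f : Module.End ℂ V) (hf : f ^ n = 1) :
    ∃ (s : Finset ℂ) (d : ℂ → ℕ), (∀ μ ∈ s, μ ^ n = 1) ∧
      ∀ m : ℕ, LinearMap.trace ℂ V (f ^ m) = ∑ μ ∈ s, d μ * μ ^ m := by
  have hss : f.IsSemisimple := by
    refine Module.End.isSemisimple_of_squarefree_aeval_eq_zero (p := Polynomial.X ^ n - 1) ?_ ?_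
    · exact (Polynomial.separable_X_pow_sub_C (1 : ℂ) (by exact_mod_cast hn.ne')
        one_ne_zero).squarefree
    · simp [hf]
  have hint : DirectSum.IsInternal f.eigenspace :=
    (DirectSum.isInternal_submodule_iff_iSupIndep_and_iSup_eq_top _).2
      ⟨f.eigenspaces_iSupIndep, hss.iSup_eigenspace_eq_top⟩
  have hfin : {μ | f.eigenspace μ ≠ ⊥}.Finite :=
    WellFoundedGT.finite_ne_bot_of_iSupIndep f.eigenspaces_iSupIndep
  have hpow : ∀ (m : ℕ) (μ : ℂ) (v : V), v ∈ f.eigenspace μ → (f ^ m) v = μ ^ m • v := by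
    intro m μ v hv
    rw [Module.End.mem_eigenspace_iff] at hv
    induction m with
    | zero => simp
    | succ k ih => rw [pow_succ', Module.End.mul_apply, ih, map_smul, hv, smul_smul, pow_succ]
  refine ⟨hfin.toFinset, fun μ ↦ Module.finrank ℂ (f.eigenspace μ), ?_, ?_⟩
  · intro μ hμ
    obtain ⟨v, hv, hv0⟩ := (Submodule.ne_bot_iff _).1 (hfin.mem_toFinset.1 hμ)
    have h := hpow n μ v hv
    rw [hf, Module.End.one_apply] at h
    by_contra hne
    have : (μ ^ n - 1) • v = 0 := by rw [sub_smul, ← h, one_smul, sub_self]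
    exact (smul_eq_zero.1 this).elim (fun h ↦ hne (sub_eq_zero.1 h)) hv0
  · intro m
    have hmaps : ∀ μ, Set.MapsTo (f ^ m) (f.eigenspace μ) (f.eigenspace μ) := by
      intro μ v hv
      change (f ^ m) v ∈ f.eigenspace μ
      rw [hpow m μ v hv]
      exact Submodule.smul_mem _ _ hv
    rw [LinearMap.trace_eq_sum_trace_restrict' hint hfin hmaps]
    refine Finset.sum_congr rfl fun μ _ ↦ ?_
    have : (f ^ m).restrict (hmaps μ) = μ ^ m • LinearMap.id := by
      ext v
      exact hpow m μ v v.2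
    rw [this, map_smul, LinearMap.trace_id, smul_eq_mul, mul_comm]

theorem Representation.exists_int_eq_prod_char_of_isCyclotomicExtension {G V K : Type*}
    [Group G] [Fintype G] [AddCommGroup V] [Module ℂ V] [FiniteDimensional ℂ V]
    (ρ : Representation ℂ G V) [Field K] [Algebra ℚ K] [IsCyclotomicExtension {Nat.card G} ℚ K] :
    ∃ z : ℤ, ∏ g ∈ Finset.univ.erase 1, ρ.character g * ρ.character g⁻¹ = z := by
  set n := Nat.card G with hn
  have hpos : 0 < n := Nat.card_pos
  have : NeZero n := ⟨hpos.ne'⟩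
  have : IsGalois ℚ K := IsCyclotomicExtension.isGalois {n} ℚ K
  have : FiniteDimensional ℚ K := IsCyclotomicExtension.finiteDimensional {n} ℚ K
  let φ : K →ₐ[ℚ] ℂ := IsAlgClosed.lift
  have hφ : Function.Injective φ := φ.injective
  obtain ⟨η, hη⟩ : ∃ η : K, IsPrimitiveRoot η n :=
    ⟨_, IsCyclotomicExtension.zeta_spec n ℚ K⟩
  have hζ : IsPrimitiveRoot (φ η) n := hη.map_of_injective hφ
  have key : ∀ g : G, ∃ (s : Finset ℂ) (d i : ℂ → ℕ),
      ∀ m : ℕ, ρ.character (g ^ m) = φ (∑ μ ∈ s, (d μ : K) * (η ^ m) ^ (i μ)) := by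
    intro g
    obtain ⟨s, d, hs, hd⟩ := Module.End.exists_trace_pow_eq_sum hpos (ρ g)
      (by rw [← map_pow, pow_card_eq_one', map_one])
    have : ∀ μ : ℂ, ∃ i : ℕ, μ ∈ s → φ η ^ i = μ := by
      intro μ
      by_cases hμ : μ ∈ s
      · obtain ⟨i, -, hi⟩ := hζ.eq_pow_of_pow_eq_one (hs μ hμ)
        exact ⟨i, fun _ ↦ hi⟩
      · exact ⟨0, fun h ↦ absurd h hμ⟩
    choose i hi using this
    refine ⟨s, d, i, fun m ↦ ?_⟩
    rw [Representation.character, map_pow, hd m, map_sum]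
    refine Finset.sum_congr rfl fun μ hμ ↦ ?_
    rw [map_mul, map_natCast, map_pow, map_pow, pow_right_comm, hi μ hμ]
  choose s d i hc using key
  let c : G → K := fun g ↦ ∑ μ ∈ s g, (d g μ : K) * η ^ (i g μ)
  have hcφ : ∀ g, φ (c g) = ρ.character g := by
    intro g
    have := hc g 1
    simp only [pow_one] at this
    exact this.symm
  have hcint : ∀ g, IsIntegral ℤ (c g) := fun g ↦
    IsIntegral.sum _ fun μ _ ↦ (isIntegral_natCast _).mul ((hη.isIntegral hpos).pow _)
  set P : K := ∏ g ∈ Finset.univ.erase 1, c g * c g⁻¹ with hP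
  have hPφ : φ P = ∏ g ∈ Finset.univ.erase 1, ρ.character g * ρ.character g⁻¹ := by
    simp only [hP, map_prod, map_mul, hcφ]
  have hPint : IsIntegral ℤ P := IsIntegral.prod _ fun g _ ↦ (hcint g).mul (hcint _)
  have hfix : ∀ σ : Gal(K/ℚ), σ P = P := by
    intro σ
    obtain ⟨m, -, hm, hσ⟩ := hη.isPrimitiveRoot_iff.1
      (hη.map_of_injective (f := σ) σ.injective)
    have hσc : ∀ g, σ (c g) = c (g ^ m) := by
      intro g
      apply hφ
      rw [hcφ, hc g m]
      simp only [c, map_sum, map_mul, map_natCast, map_pow, ← hσ]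
    simp only [hP, map_prod, map_mul, hσc]
    refine Finset.prod_equiv (powCoprime (G := G) hm.symm) ?_ ?_
    · intro g
      have := (powCoprime (G := G) hm.symm).injective.eq_iff (a := g) (b := 1)
      rw [powCoprime_one] at this
      simp only [Finset.mem_erase, Finset.mem_univ, and_true, ne_eq, this]
    · intro g _
      simp [powCoprime]
  obtain ⟨q, hq⟩ := (IsGalois.mem_range_algebraMap_iff_fixed P).2 hfix
  rw [← hq, isIntegral_algebraMap_iff (algebraMap ℚ K).injective] at hPint
  obtain ⟨z, hz⟩ := IsIntegrallyClosed.isIntegral_iff.1 hPint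
  refine ⟨z, ?_⟩
  rw [← hPφ, ← hq, ← hz]
  simp

/-- The product of the values `χ g * χ g⁻¹` over `g ≠ 1` is a Galois-stable algebraic integer,
hence an integer. -/
theorem Representation.exists_int_eq_prod_char {G V : Type*} [Group G] [Fintype G] [AddCommGroup V]
    [Module ℂ V] [FiniteDimensional ℂ V] (ρ : Representation ℂ G V) :
    ∃ z : ℤ, ∏ g ∈ Finset.univ.erase 1, ρ.character g * ρ.character g⁻¹ = z :=
  let : Algebra ℚ (CyclotomicField (Nat.card G) ℚ) := CyclotomicField.algebra _ _
  ρ.exists_int_eq_prod_char_of_isCyclotomicExtension (K := CyclotomicField (Nat.card G) ℚ)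

theorem Representation.char_inv_eq_conj {G V : Type*} [Group G] [Finite G] [AddCommGroup V]
    [Module ℂ V] [FiniteDimensional ℂ V] (ρ : Representation ℂ G V) (g : G) :
    ρ.character g⁻¹ = starRingEnd ℂ (ρ.character g) := by
  have hpos : 0 < Nat.card G := Nat.card_pos
  obtain ⟨s, d, hs, hd⟩ := Module.End.exists_trace_pow_eq_sum hpos (ρ g)
      (by rw [← map_pow, pow_card_eq_one', map_one])
  have hg : g⁻¹ = g ^ (Nat.card G - 1) := by
    rw [inv_eq_iff_mul_eq_one, ← pow_succ', Nat.sub_add_cancel hpos, pow_card_eq_one']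
  have h1 := hd 1
  rw [pow_one] at h1
  rw [Representation.character, Representation.character, hg, map_pow, hd, h1, map_sum]
  refine Finset.sum_congr rfl fun μ hμ ↦ ?_
  have hμ1 : μ ^ (Nat.card G - 1) * μ = 1 := by
    rw [← pow_succ, Nat.sub_add_cancel hpos, hs μ hμ]
  have hnorm : ‖μ‖ = 1 := Complex.norm_eq_one_of_pow_eq_one (hs μ hμ) hpos.ne'
  rw [pow_one, map_mul, map_natCast, eq_inv_of_mul_eq_one_left hμ1, Complex.inv_def,
    Complex.normSq_eq_norm_sq, hnorm]
  simp

/-- **Burnside's theorem**: a complex character of norm one that has no zeros is linear. -/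
theorem Representation.finrank_le_one_of_char_ne_zero {G V : Type*} [Group G] [Fintype G]
    [AddCommGroup V] [Module ℂ V] [FiniteDimensional ℂ V] (ρ : Representation ℂ G V)
    (hρ : ∑ g : G, ρ.character g * ρ.character g⁻¹ = Nat.card G)
    (h0 : ∀ g, ρ.character g ≠ 0) : Module.finrank ℂ V ≤ 1 := by
  have hsq : ∀ g, ρ.character g * ρ.character g⁻¹ = ((‖ρ.character g‖ ^ 2 : ℝ) : ℂ) := by
    intro g
    rw [ρ.char_inv_eq_conj, Complex.mul_conj, Complex.normSq_eq_norm_sq]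
  have hpos : ∀ g, 0 < ‖ρ.character g‖ ^ 2 := fun g ↦ by
    have := norm_pos_iff.2 (h0 g)
    positivity
  obtain ⟨z, hz⟩ := ρ.exists_int_eq_prod_char
  simp only [hsq] at hz hρ
  have hz' : ∏ g ∈ Finset.univ.erase 1, ‖ρ.character g‖ ^ 2 = (z : ℝ) := by exact_mod_cast hz
  have hρ' : ∑ g : G, ‖ρ.character g‖ ^ 2 = Nat.card G := by exact_mod_cast hρ
  have hP : (0 : ℝ) < z := hz' ▸ Finset.prod_pos fun g _ ↦ hpos g
  have hP1 : (1 : ℝ) ≤ z := by exact_mod_cast hP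
  have hlog : 0 ≤ ∑ g ∈ Finset.univ.erase (1 : G), Real.log (‖ρ.character g‖ ^ 2) := by
    rw [← Real.log_prod fun g _ ↦ (hpos g).ne', hz']
    exact Real.log_nonneg hP1
  have hle : ∑ g ∈ Finset.univ.erase (1 : G), Real.log (‖ρ.character g‖ ^ 2) ≤
      ∑ g ∈ Finset.univ.erase (1 : G), (‖ρ.character g‖ ^ 2 - 1) :=
    Finset.sum_le_sum fun g _ ↦ Real.log_le_sub_one_of_pos (hpos g)
  rw [Finset.sum_sub_distrib] at hle
  rw [← Finset.add_sum_erase _ _ (Finset.mem_univ (1 : G)), ρ.char_one] at hρ'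
  simp only [Finset.sum_const, Finset.card_erase_of_mem (Finset.mem_univ (1 : G)),
    Finset.card_univ, nsmul_eq_mul, mul_one, Complex.norm_natCast] at hle hρ'
  rw [Nat.card_eq_fintype_card] at hρ'
  rw [Nat.cast_pred Fintype.card_pos] at hle
  have : (Module.finrank ℂ V : ℝ) ^ 2 ≤ 1 := by linarith
  have : (Module.finrank ℂ V : ℝ) ≤ 1 := by nlinarith
  exact_mod_cast this

theorem Representation.finrank_le_one_of_forall_not_isVanishing {G : Type} [Group G] [Finite G]
    (h : ∀ g : G, ¬ IsVanishing G g) {V : Type} [AddCommGroup V] [Module ℂ V]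
    [FiniteDimensional ℂ V] (ρ : Representation ℂ G V) [ρ.IsIrreducible] :
    Module.finrank ℂ V ≤ 1 := by
  have := Fintype.ofFinite G
  have hne : (Nat.card G : ℂ) ≠ 0 := Nat.cast_ne_zero.2 Nat.card_pos.ne'
  have := invertibleOfNonzero hne
  have hnorm : ∑ g : G, ρ.character g * ρ.character g⁻¹ = Nat.card G := by
    have := ρ.char_orthonormal ρ
    rw [if_pos ⟨Representation.Equiv.refl ρ⟩, inv_mul_eq_one₀ hne] at this
    exact this.symm
  refine ρ.finrank_le_one_of_char_ne_zero hnorm fun g hg ↦ h g ⟨FDRep.of ρ, ?_, hg⟩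
  exact (FDRep.simple_iff_char_is_norm_one _).2 hnorm

theorem Representation.commute_of_forall_not_isVanishing {G : Type} [Group G] [Finite G]
    (h : ∀ g : G, ¬ IsVanishing G g) {V : Type} [AddCommGroup V] [Module ℂ V]
    [FiniteDimensional ℂ V] (ρ : Representation ℂ G V) (a b : G) : Commute (ρ a) (ρ b) := by
  have : NeZero (Nat.card G : ℂ) := ⟨Nat.cast_ne_zero.2 Nat.card_pos.ne'⟩
  by_cases hV : Module.finrank ℂ V ≤ 1
  · obtain ⟨w, hw⟩ := finrank_le_one_iff.1 hV
    obtain ⟨x, hx⟩ := hw (ρ a w)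
    obtain ⟨y, hy⟩ := hw (ρ b w)
    refine LinearMap.ext fun v ↦ ?_
    obtain ⟨z, rfl⟩ := hw v
    simp only [Module.End.mul_apply, map_smul, ← hx, ← hy, smul_smul]
    congr 1
    ring
  · have hnontriv : Nontrivial V := by
      rw [← Module.finrank_pos_iff (R := ℂ)]
      omega
    have hirr : ¬ ρ.IsIrreducible := fun _ ↦ hV (ρ.finrank_le_one_of_forall_not_isVanishing h)
    obtain ⟨S, hS0, hS1⟩ : ∃ S : Subrepresentation ρ, S ≠ ⊥ ∧ S ≠ ⊤ := by
      by_contra! hcon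
      refine hirr { exists_pair_ne := ⟨⊥, ⊤, fun heq ↦ ?_⟩, eq_bot_or_eq_top := fun S ↦ ?_ }
      · exact bot_ne_top (congrArg Subrepresentation.toSubmodule heq)
      · exact or_iff_not_imp_left.2 (hcon S)
    obtain ⟨T, hST⟩ := exists_isCompl S
    have hT1 : T ≠ ⊤ := fun hT ↦ hS0 (by simpa [hT] using hST.inf_eq_bot)
    have hlt : ∀ U : Subrepresentation ρ, U ≠ ⊤ →
        Module.finrank ℂ U.toSubmodule < Module.finrank ℂ V := fun U hU ↦
      Submodule.finrank_lt fun hU' ↦ hU (Subrepresentation.toSubmodule_injective hU')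
    have hsub : ∀ U : Subrepresentation ρ, U ≠ ⊤ → ∀ u ∈ U.toSubmodule,
        (ρ a * ρ b) u = (ρ b * ρ a) u := by
      intro U hU u hu
      have := hlt U hU
      have hc := commute_of_forall_not_isVanishing h U.toRepresentation a b
      exact congrArg Subtype.val (LinearMap.congr_fun hc.eq ⟨u, hu⟩)
    refine LinearMap.ext fun v ↦ ?_
    have hv : v ∈ S.toSubmodule ⊔ T.toSubmodule := by
      rw [← Subrepresentation.toSubmodule_sup, hST.sup_eq_top]
      exact Submodule.mem_top
    obtain ⟨s, hs, t, ht, rfl⟩ := Submodule.mem_sup.1 hv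
    rw [map_add, map_add, hsub S hS1 s hs, hsub T hT1 t ht]
termination_by Module.finrank ℂ V

/-- A finite group without vanishing elements is commutative. -/
theorem commute_of_forall_not_isVanishing {G : Type} [Group G] [Finite G]
    (h : ∀ g : G, ¬ IsVanishing G g) (a b : G) : Commute a b := by
  have := (Representation.leftRegular ℂ G).commute_of_forall_not_isVanishing h a b
  have := LinearMap.congr_fun this.eq (MonoidAlgebra.single 1 1)
  have : MonoidAlgebra.single (a * b) (1 : ℂ) = MonoidAlgebra.single (b * a) 1 := by
    simpa using this
  exact MonoidAlgebra.of_injective (R := ℂ) this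

theorem not_isVanishing_of_mem_center {G : Type} [Group G] [Finite G] {z : G}
    (hz : z ∈ Subgroup.center G) : ¬ IsVanishing G z := by
  rintro ⟨V, hV, hχ⟩
  have : NeZero (Nat.card G : ℂ) := ⟨Nat.cast_ne_zero.2 Nat.card_pos.ne'⟩
  have hrank := (FDRep.simple_iff_end_is_rank_one V).1 hV
  let f : V ⟶ V :=
    { hom := Action.ρ V z
      comm := fun g ↦ by
        rw [← CategoryTheory.End.mul_def, ← CategoryTheory.End.mul_def, ← map_mul, ← map_mul,
          Subgroup.mem_center_iff.1 hz g] }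
  have hid : CategoryTheory.CategoryStruct.id V ≠ 0 := CategoryTheory.id_nonzero V
  obtain ⟨c, hc⟩ := (finrank_eq_one_iff_of_nonzero' _ hid).1 hrank f
  have hρ : V.ρ z = c • LinearMap.id := by
    have := congrArg (fun φ : V ⟶ V ↦ φ.hom.hom.hom) hc
    exact this.symm
  have hone : V.ρ 1 = 0 := by
    have hχ' : c * Module.finrank ℂ V = 0 := by
      rw [← hχ, FDRep.character, hρ, map_smul, LinearMap.trace_id, smul_eq_mul]
    rcases mul_eq_zero.1 hχ' with h | h
    · rw [← mul_inv_cancel z, map_mul, hρ, h, zero_smul, zero_mul]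
    · have := Module.finrank_zero_iff.1 (Nat.cast_eq_zero.1 h)
      exact Subsingleton.elim _ _
  have hzero : ∀ g, V.character g = 0 := fun g ↦ by
    rw [FDRep.character, ← mul_one g, map_mul, hone, mul_zero, map_zero]
  have := Fintype.ofFinite G
  have hnorm := (FDRep.simple_iff_char_is_norm_one V).1 hV
  simp only [hzero, mul_zero, Finset.sum_const_zero] at hnorm
  exact NeZero.ne _ hnorm.symm

/-- Vanishing elements lift along quotient maps, by inflation of characters. -/
theorem IsVanishing.of_quotient {G : Type} [Group G] [Finite G] {N : Subgroup G} [N.Normal] {g : G}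
    (hg : IsVanishing (G ⧸ N) g) : IsVanishing G g := by
  obtain ⟨V, hV, hχ⟩ := hg
  have := Fintype.ofFinite G
  have := Fintype.ofFinite (G ⧸ N)
  let W : FDRep ℂ G := FDRep.of ((V.ρ).comp (QuotientGroup.mk' N))
  have hW : ∀ g : G, W.character g = V.character (g : G ⧸ N) := fun _ ↦ rfl
  refine ⟨W, ?_, (hW g).trans hχ⟩
  rw [FDRep.simple_iff_char_is_norm_one] at hV ⊢
  simp only [hW, QuotientGroup.mk_inv]
  rw [← Finset.sum_fiberwise (s := Finset.univ) (g := ((↑) : G → G ⧸ N)),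
    ← N.card_mul_index, Nat.cast_mul, Subgroup.index, ← hV, Finset.mul_sum]
  refine Finset.sum_congr rfl fun q _ ↦ ?_
  rw [Finset.sum_congr rfl (g := fun _ ↦ V.character q * V.character q⁻¹) (by
    intro x hx
    rw [(Finset.mem_filter.1 hx).2]), Finset.sum_const, nsmul_eq_mul]
  congr 2
  obtain ⟨g, rfl⟩ := QuotientGroup.mk_surjective q
  rw [← Fintype.card_subtype, ← Nat.card_eq_fintype_card]
  refine (Nat.card_congr ((Equiv.mulLeft g).subtypeEquiv fun n ↦ ?_)).symm
  rw [Equiv.coe_mulLeft, eq_comm, QuotientGroup.eq, inv_mul_cancel_left]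

theorem exists_commute_of_not_dvd_card {G : Type*} [Group G] [Finite G] {p : ℕ} (hp : p.Prime)
    {a : G} {k : ℕ} (ha : orderOf a = p ^ k) (T : Set G) (hT : ∀ t ∈ T, a * t * a⁻¹ ∈ T)
    (hpT : ¬ p ∣ Nat.card T) : ∃ t ∈ T, Commute a t := by
  have := Fact.mk hp
  have hmem : ∀ b ∈ Subgroup.zpowers a, ∀ t ∈ T, b * t * b⁻¹ ∈ T := by
    intro b hb
    rw [← mem_powers_iff_mem_zpowers] at hb
    obtain ⟨n, rfl⟩ := hb
    induction n with
    | zero => simp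
    | succ n ih =>
      intro t ht
      have := hT _ (ih t ht)
      simpa only [pow_succ', mul_inv_rev, mul_assoc] using this
  let : MulAction (Subgroup.zpowers a) T :=
    { smul := fun b t ↦ ⟨b * t * (b : G)⁻¹, hmem b b.2 t t.2⟩
      one_smul := fun t ↦ Subtype.ext (by change (1 : G) * t * 1⁻¹ = t; simp)
      mul_smul := fun b c t ↦ Subtype.ext (by
        change ((b * c : G)) * t * (b * c : G)⁻¹ = b * (c * t * (c : G)⁻¹) * (b : G)⁻¹
        group) }
  have hP : IsPGroup p (Subgroup.zpowers a) :=
    IsPGroup.of_card (n := k) (by rw [Nat.card_zpowers, ha])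
  obtain ⟨t, ht⟩ := hP.nonempty_fixed_point_of_prime_not_dvd_card T hpT
  have h : a * t * a⁻¹ = t := congrArg Subtype.val (ht ⟨a, Subgroup.mem_zpowers a⟩)
  exact ⟨t, t.2, mul_inv_eq_iff_eq_mul.1 h⟩

theorem card_dvd_of_conj_transitive {G : Type*} [Group G] [Finite G] (M : Subgroup G) (z : G) :
    Nat.card {w : G | ∃ m ∈ M, m * z * m⁻¹ = w} ∣ Nat.card M := by
  let ψ : M →* MulAut G := MulAut.conj.comp M.subtype
  let : MulAction M G := MulAction.compHom G ψ
  have hset : {w : G | ∃ m ∈ M, m * z * m⁻¹ = w} = MulAction.orbit M z := by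
    ext w
    constructor
    · rintro ⟨m, hm, rfl⟩
      exact ⟨⟨m, hm⟩, rfl⟩
    · rintro ⟨m, rfl⟩
      exact ⟨m, m.2, rfl⟩
  rw [hset, Nat.card_congr (MulAction.orbitEquivQuotientStabilizer M z)]
  exact Subgroup.card_quotient_dvd_card _

theorem card_conjugators_dvd {G : Type*} [Group G] [Finite G] (M : Subgroup G) {z w m : G}
    (hm : m ∈ M) (hmz : m * z * m⁻¹ = w) :
    Nat.card {n : G | n ∈ M ∧ n * z * n⁻¹ = w} ∣ Nat.card M := by
  have : Nat.card {n : G | n ∈ M ∧ n * z * n⁻¹ = w} =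
      Nat.card (M ⊓ Subgroup.centralizer {z} : Subgroup G) := by
    refine (Nat.card_congr ?_).symm
    refine (Equiv.mulLeft m).subtypeEquiv fun c ↦ ?_
    simp only [Set.mem_ofPred_eq, Equiv.coe_mulLeft, Subgroup.mem_inf,
      Subgroup.mem_centralizer_singleton_iff, Subgroup.mul_mem_cancel_left M hm, ← hmz]
    refine and_congr_right fun _ ↦ ?_
    constructor
    · intro h
      rw [mul_inv_rev, ← mul_assoc, mul_assoc m c z, h]
      group
    · intro h
      have : m * (c * z * c⁻¹) * m⁻¹ = m * z * m⁻¹ := by rw [← h]; group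
      have := mul_left_cancel (mul_right_cancel this)
      rw [mul_inv_eq_iff_eq_mul] at this
      exact this
  rw [this]
  exact Subgroup.card_dvd_of_le inf_le_left

/-- A Glauberman-type lemma: let `S` be a finite set of commuting elements whose orders are powers of
primes not dividing the order of the normal subgroup `N`. If `S` normalizes the `N`-conjugacy class
of `x`, then `S` centralizes an element of that class, and the elements of the class centralized
by `S` are conjugate under the centralizer of `S` in `N`. -/
theorem exists_commute_of_coprime {G : Type*} [Group G] [Finite G] (N : Subgroup G) [N.Normal]
    (x : G) (S : Finset G) (hcomm : ∀ a ∈ S, ∀ b ∈ S, Commute a b)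
    (hord : ∀ a ∈ S, ∃ p k : ℕ, p.Prime ∧ orderOf a = p ^ k ∧ ¬ p ∣ Nat.card N)
    (hinv : ∀ a ∈ S, ∃ n ∈ N, n * x * n⁻¹ = a * x * a⁻¹) :
    (∃ n ∈ N, ∀ a ∈ S, Commute a (n * x * n⁻¹)) ∧
      ∀ n ∈ N, ∀ n' ∈ N, (∀ a ∈ S, Commute a (n * x * n⁻¹)) →
        (∀ a ∈ S, Commute a (n' * x * n'⁻¹)) →
        ∃ m ∈ N, (∀ a ∈ S, Commute a m) ∧ m * (n * x * n⁻¹) * m⁻¹ = n' * x * n'⁻¹ := by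
  induction S using Finset.induction_on with
  | empty =>
    refine ⟨⟨1, N.one_mem, by simp⟩, fun n hn n' hn' _ _ ↦
      ⟨n' * n⁻¹, N.mul_mem hn' (N.inv_mem hn), by simp, by group⟩⟩
  | insert a S _ ih =>
    simp only [Finset.forall_mem_insert] at hcomm hord hinv ⊢
    obtain ⟨⟨n₀, hn₀, hfix⟩, htrans⟩ := ih (fun b hb c hc ↦ (hcomm.2 b hb).2 c hc) hord.2 hinv.2
    obtain ⟨p, k, hp, hak, hpN⟩ := hord.1
    let M : Subgroup G := N ⊓ Subgroup.centralizer S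
    have hM : ∀ m, m ∈ M ↔ m ∈ N ∧ ∀ b ∈ S, Commute b m := fun m ↦ Iff.rfl
    have hMN : Nat.card M ∣ Nat.card N := Subgroup.card_dvd_of_le inf_le_left
    have hMa : ∀ m ∈ M, a * m * a⁻¹ ∈ M := fun m hm ↦
      ⟨‹N.Normal›.conj_mem m hm.1 a, fun b hb ↦ by
        have h1 : Commute b a := ((hcomm.2 b hb).1)
        exact (h1.mul_right (((hM m).1 hm).2 b hb)).mul_right h1.inv_right⟩
    have hconj : ∀ n ∈ N, ∃ n' ∈ N, n' * x * n'⁻¹ = a * (n * x * n⁻¹) * a⁻¹ := by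
      intro n hn
      obtain ⟨l, hl, hlx⟩ := hinv.1
      refine ⟨a * n * a⁻¹ * l, N.mul_mem (‹N.Normal›.conj_mem n hn a) hl, ?_⟩
      calc _ = a * n * a⁻¹ * (l * x * l⁻¹) * (a * n * a⁻¹)⁻¹ := by group
        _ = _ := by rw [hlx]; group
    constructor
    · obtain ⟨t, ⟨m, hm, rfl⟩, hta⟩ := exists_commute_of_not_dvd_card hp hak
        {w : G | ∃ m ∈ M, m * (n₀ * x * n₀⁻¹) * m⁻¹ = w} (by
          rintro _ ⟨m, hm, rfl⟩
          obtain ⟨n', hn', hn'x⟩ := hconj (m * n₀) (N.mul_mem hm.1 hn₀)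
          have heq : n' * x * n'⁻¹ = a * (m * (n₀ * x * n₀⁻¹) * m⁻¹) * a⁻¹ := by
            rw [hn'x]; group
          obtain ⟨m', hm', hm'c, hm'x⟩ := htrans n₀ hn₀ n' hn' hfix (fun b hb ↦ by
            rw [heq]
            have h1 : Commute b a := (hcomm.2 b hb).1
            have h2 : Commute b m := ((hM m).1 hm).2 b hb
            exact (h1.mul_right ((h2.mul_right (hfix b hb)).mul_right h2.inv_right)).mul_right
              h1.inv_right)
          exact ⟨m', (hM m').2 ⟨hm', hm'c⟩, by rw [hm'x, heq]⟩)
        (fun h ↦ hpN ((h.trans (card_dvd_of_conj_transitive M _)).trans hMN))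
      refine ⟨m * n₀, N.mul_mem hm.1 hn₀, ?_⟩
      have heq : m * n₀ * x * (m * n₀)⁻¹ = m * (n₀ * x * n₀⁻¹) * m⁻¹ := by group
      rw [heq]
      refine ⟨hta, fun b hb ↦ ?_⟩
      have h2 : Commute b m := ((hM m).1 hm).2 b hb
      exact (h2.mul_right (hfix b hb)).mul_right h2.inv_right
    · intro n hn n' hn' hnS hn'S
      obtain ⟨m₀, hm₀, hm₀c, hm₀x⟩ := htrans n hn n' hn' hnS.2 hn'S.2
      obtain ⟨m, ⟨hm, hmx⟩, hma⟩ := exists_commute_of_not_dvd_card hp hak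
        {m : G | m ∈ M ∧ m * (n * x * n⁻¹) * m⁻¹ = n' * x * n'⁻¹} (by
          rintro m ⟨hm, hmx⟩
          refine ⟨hMa m hm, ?_⟩
          have h1 : a * (n * x * n⁻¹) * a⁻¹ = n * x * n⁻¹ := mul_inv_eq_iff_eq_mul.2 hnS.1
          have h2 : a * (n' * x * n'⁻¹) * a⁻¹ = n' * x * n'⁻¹ := mul_inv_eq_iff_eq_mul.2 hn'S.1
          calc a * m * a⁻¹ * (n * x * n⁻¹) * (a * m * a⁻¹)⁻¹
              = a * m * a⁻¹ * (a * (n * x * n⁻¹) * a⁻¹) * (a * m * a⁻¹)⁻¹ := by rw [h1]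
            _ = a * (m * (n * x * n⁻¹) * m⁻¹) * a⁻¹ := by group
            _ = _ := by rw [hmx, h2])
        (fun h ↦ hpN ((h.trans
          (card_conjugators_dvd M ((hM m₀).2 ⟨hm₀, hm₀c⟩) hm₀x)).trans hMN))
      exact ⟨m, hm.1, ⟨hma, ((hM m).1 hm).2⟩, hmx⟩

theorem Subgroup.le_of_forall_primePow_mem {G : Type*} [Group G] [Finite G] {H C : Subgroup G}
    (h : ∀ a ∈ H, (∃ p k : ℕ, p.Prime ∧ orderOf a = p ^ k) → a ∈ C) : H ≤ C := by
  rw [← Subgroup.subgroupOf_eq_top, ← Subgroup.index_eq_one]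
  by_contra hne
  obtain ⟨p, hp, hdvd⟩ := Nat.exists_prime_and_dvd hne
  have := Fact.mk hp
  obtain ⟨P⟩ : Nonempty (Sylow p H) := inferInstance
  refine P.not_dvd_index (hdvd.trans (Subgroup.index_dvd_of_le fun a ha ↦ ?_))
  rw [Subgroup.mem_subgroupOf]
  obtain ⟨k, hk⟩ := (IsPGroup.iff_orderOf.1 P.isPGroup') ⟨a, ha⟩
  refine h a a.2 ⟨p, k, hp, ?_⟩
  rw [Subgroup.orderOf_mk] at hk
  rw [Subgroup.orderOf_coe, hk]

theorem quotient_commute_of_isHallSubgroup {G : Type} [Group G] [Finite G] {π : Set ℕ}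
    (hv : ∀ n ∈ vcs G, ∀ p : ℕ, p.Prime → p ∣ n → p ∈ π) {N : Subgroup G} [N.Normal]
    (hN : IsHallSubgroup π N) (a b : G ⧸ N) : Commute a b := by
  refine commute_of_forall_not_isVanishing (fun q hq ↦ ?_) a b
  obtain ⟨g, rfl⟩ := QuotientGroup.mk_surjective q
  refine not_isVanishing_of_mem_center ?_ hq
  have hle : (Subgroup.centralizer {g}).map (QuotientGroup.mk' N) ≤
      Subgroup.centralizer {(g : G ⧸ N)} := by
    rintro _ ⟨c, hc, rfl⟩
    rw [SetLike.mem_coe, Subgroup.mem_centralizer_singleton_iff] at hc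
    rw [Subgroup.mem_centralizer_singleton_iff]
    exact congrArg ((↑) : G → G ⧸ N) hc
  have hdvd : (Subgroup.centralizer {(g : G ⧸ N)}).index ∣ (Subgroup.centralizer {g}).index :=
    (Subgroup.index_dvd_of_le hle).trans
      (Subgroup.index_map_dvd _ (QuotientGroup.mk'_surjective N))
  have hone : (Subgroup.centralizer {(g : G ⧸ N)}).index = 1 := by
    by_contra hne
    obtain ⟨p, hp, hpd⟩ := Nat.exists_prime_and_dvd hne
    exact hN.2 p hp (hpd.trans (Subgroup.index_dvd_card _))
      (hv _ ⟨g, hq.of_quotient, rfl⟩ p hp (hpd.trans hdvd))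
  rw [Subgroup.index_eq_one] at hone
  exact Subgroup.mem_center_iff.2 fun y ↦
    Subgroup.mem_centralizer_singleton_iff.1 (hone ▸ Subgroup.mem_top y)

open scoped commutatorElement in
/-- A `π`-complement of a normal Hall `π`-subgroup with commutative quotient is commutative. -/
theorem IsHallSubgroup.commute_of_quotient_commute {G : Type*} [Group G] {π : Set ℕ}
    {N H : Subgroup G} [N.Normal] (hH : IsHallSubgroup πᶜ H) (hN : IsHallSubgroup π N)
    (hcomm : ∀ a b : G ⧸ N, Commute a b) : ∀ a ∈ H, ∀ b ∈ H, Commute a b := by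
  intro a ha b hb
  have hcN : ⁅a, b⁆ ∈ N := by
    rw [← QuotientGroup.eq_one_iff]
    exact commutatorElement_eq_one_iff_commute.2 (hcomm a b)
  have hcH : ⁅a, b⁆ ∈ H :=
    H.mul_mem (H.mul_mem (H.mul_mem ha hb) (H.inv_mem ha)) (H.inv_mem hb)
  rw [← commutatorElement_eq_one_iff_commute, ← orderOf_eq_one_iff]
  by_contra hne
  obtain ⟨p, hp, hpd⟩ := Nat.exists_prime_and_dvd hne
  exact hH.1 p hp (hpd.trans (Subgroup.orderOf_dvd_natCard H hcH))
    (hN.1 p hp (hpd.trans (Subgroup.orderOf_dvd_natCard N hcN)))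

/-- Lemma 2.1(b): if every vanishing class size of `G` is divisible only by
primes in `π`, `N` is a normal Hall `π`-subgroup and `H` a `π`-complement, and
`x ∈ N` is a vanishing element of `G`, then `x ∈ C_N(H^y)` for some `y ∈ N`. -/
theorem statement3 (G : Type) [Group G] [Finite G] (π : Set ℕ)
    (hv : ∀ n ∈ vcs G, ∀ p : ℕ, p.Prime → p ∣ n → p ∈ π)
    (N H : Subgroup G) (hN : N.Normal) (hNhall : IsHallSubgroup π N)
    (hHhall : IsHallSubgroup πᶜ H)
    (x : G) (hx : x ∈ N) (hvan : IsVanishing G x) :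
    ∃ y ∈ N, ∀ h ∈ H, Commute x (y⁻¹ * h * y) := by
  have hcomm := hHhall.commute_of_quotient_commute hNhall
    (quotient_commute_of_isHallSubgroup hv hNhall)
  have hsup : N ⊔ Subgroup.centralizer {x} = ⊤ := by
    rw [← Subgroup.index_eq_one]
    by_contra hne
    obtain ⟨p, hp, hpd⟩ := Nat.exists_prime_and_dvd hne
    exact hNhall.2 p hp (hpd.trans (Subgroup.index_dvd_of_le le_sup_left))
      (hv _ ⟨x, hvan, rfl⟩ p hp (hpd.trans (Subgroup.index_dvd_of_le le_sup_right)))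
  have := Fintype.ofFinite G
  let S : Finset G := {a | a ∈ H ∧ ∃ p k : ℕ, p.Prime ∧ orderOf a = p ^ k ∧ ¬ p ∣ Nat.card N}
  have hS : ∀ a, a ∈ S ↔ a ∈ H ∧ ∃ p k : ℕ, p.Prime ∧ orderOf a = p ^ k ∧ ¬ p ∣ Nat.card N := by
    simp [S]
  obtain ⟨n, hn, hfix⟩ := (exists_commute_of_coprime N x S
    (fun a ha b hb ↦ hcomm a ((hS a).1 ha).1 b ((hS b).1 hb).1) (fun a ha ↦ ((hS a).1 ha).2)
    (fun a _ ↦ by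
      obtain ⟨n, hn, c, hc, rfl⟩ := Subgroup.mem_sup_of_normal_left.1 (hsup ▸ Subgroup.mem_top a)
      rw [Subgroup.mem_centralizer_singleton_iff] at hc
      refine ⟨n, hn, ?_⟩
      rw [mul_inv_rev, mul_assoc n c x, hc]
      group)).1
  have hle : H ≤ Subgroup.centralizer {n * x * n⁻¹} := by
    refine Subgroup.le_of_forall_primePow_mem fun a ha ⟨p, k, hp, hak⟩ ↦ ?_
    rw [Subgroup.mem_centralizer_singleton_iff]
    rcases Nat.eq_zero_or_pos k with rfl | hk
    · rw [pow_zero, orderOf_eq_one_iff] at hak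
      simp [hak]
    · refine hfix a ((hS a).2 ⟨ha, p, k, hp, hak, fun hpN ↦ ?_⟩)
      refine hHhall.1 p hp ?_ (hNhall.1 p hp hpN)
      exact (hak ▸ dvd_pow_self p hk.ne').trans (Subgroup.orderOf_dvd_natCard H ha)
  refine ⟨n, hn, fun h hh ↦ ?_⟩
  have hc := Subgroup.mem_centralizer_singleton_iff.1 (hle hh)
  have hc' : n * (n⁻¹ * h * n * x) * n⁻¹ = n * (x * (n⁻¹ * h * n)) * n⁻¹ := by
    calc _ = h * (n * x * n⁻¹) := by group
      _ = n * x * n⁻¹ * h := hc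
      _ = _ := by group
  exact (mul_left_cancel (mul_right_cancel hc')).symm
end
end

section
/- Let G be a finite group, π a set of primes, N a normal Hall π-subgroup of G, and H a π-complement of G. If H is abelian, then C_H(N) = Z(G) ∩ H; furthermore, for every g ∈ G, the conjugacy class size of the coset gC_H(N) in G/C_H(N) equals the conjugacy class size of g in G, and in particular vcs(G/C_H(N)) ⊆ vcs(G). -/
open scoped Classical

noncomputable section

/-- Inflation along a surjective homomorphism preserves simplicity. -/
theorem FDRep.simple_res_of_surjective {G K : Type} [Group G] [Group K] [Finite G] [Finite K]
    (f : G →* K) (hf : Function.Surjective f) (V : FDRep ℂ K) (hV : CategoryTheory.Simple V) :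
    CategoryTheory.Simple (C := FDRep ℂ G) ((Action.res (FGModuleCat ℂ) f).obj V) := by
  have : NeZero (Nat.card G : ℂ) := ⟨Nat.cast_ne_zero.2 Nat.card_pos.ne'⟩
  have : NeZero (Nat.card K : ℂ) := ⟨Nat.cast_ne_zero.2 Nat.card_pos.ne'⟩
  rw [FDRep.simple_iff_end_is_rank_one] at hV ⊢
  rw [← hV]
  let e : (V ⟶ V) ≃ₗ[ℂ]
      ((Action.res (FGModuleCat ℂ) f).obj V ⟶ (Action.res (FGModuleCat ℂ) f).obj V) :=
    { toFun := fun φ => ⟨φ.hom, fun g => φ.comm (f g)⟩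
      invFun := fun φ => ⟨φ.hom, fun k => by
        obtain ⟨g, rfl⟩ := hf k
        exact φ.comm g⟩
      map_add' := fun _ _ => rfl
      map_smul' := fun _ _ => rfl
      left_inv := fun _ => rfl
      right_inv := fun _ => rfl }
  exact e.finrank_eq.symm

theorem IsVanishing.of_surjective {G K : Type} [Group G] [Group K] [Finite G] [Finite K]
    (f : G →* K) (hf : Function.Surjective f) {g : G} (h : IsVanishing K (f g)) :
    IsVanishing G g := by
  obtain ⟨V, hV, hg⟩ := h
  exact ⟨_, FDRep.simple_res_of_surjective f hf V hV, hg⟩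

theorem vcs_subset_of_surjective {G K : Type} [Group G] [Group K] [Finite G] [Finite K]
    (f : G →* K) (hf : Function.Surjective f) (hcs : ∀ g, classSize (f g) = classSize g) :
    vcs K ⊆ vcs G := by
  rintro n ⟨k, hk, rfl⟩
  obtain ⟨g, rfl⟩ := hf k
  exact ⟨g, hk.of_surjective f hf, (hcs g).symm⟩

theorem classSize_map_of_surjective {G K : Type*} [Group G] [Group K] (f : G →* K)
    (hf : Function.Surjective f) (hcomm : ∀ a b : G, f (a * b) = f (b * a) → a * b = b * a)
    (g : G) : classSize (f g) = classSize g := by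
  unfold classSize
  rw [← Subgroup.index_comap_of_surjective _ hf]
  congr 1
  ext x
  simp only [Subgroup.mem_comap, Subgroup.mem_centralizer_singleton_iff, ← map_mul]
  exact ⟨fun h => hcomm _ _ h, fun h => by rw [h]⟩

theorem IsHallSubgroup.isCompl {G : Type*} [Group G] [Finite G] {π : Set ℕ} {N H : Subgroup G}
    (hN : IsHallSubgroup π N) (hH : IsHallSubgroup πᶜ H) : IsCompl N H := by
  constructor
  · exact Subgroup.disjoint_of_coprime_natCard <| Nat.coprime_of_dvd fun p hp h₁ h₂ =>
      hH.1 p hp h₂ (hN.1 p hp h₁)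
  · rw [codisjoint_iff, ← Subgroup.index_eq_one, Nat.eq_one_iff_not_exists_prime_dvd]
    exact fun p hp h => hH.2 p hp (h.trans (Subgroup.index_dvd_of_le le_sup_right))
      (hN.2 p hp (h.trans (Subgroup.index_dvd_of_le le_sup_left)))

theorem IsAbelianSubgroup.centralizer_inf_eq {G : Type*} [Group G] {N H : Subgroup G}
    (hH : IsAbelianSubgroup H) (htop : N ⊔ H = ⊤) :
    Subgroup.centralizer (N : Set G) ⊓ H = Subgroup.center G ⊓ H := by
  refine le_antisymm (fun z hz => ⟨?_, hz.2⟩)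
    (inf_le_inf_right H (Subgroup.center_le_centralizer _))
  have hle : N ⊔ H ≤ Subgroup.centralizer {z} :=
    sup_le (fun n hn => Subgroup.mem_centralizer_singleton_iff.2 (hz.1 n hn))
      (fun h hh => Subgroup.mem_centralizer_singleton_iff.2 (hH h hh z hz.2))
  rw [htop] at hle
  exact Subgroup.mem_center_iff.2 fun g =>
    Subgroup.mem_centralizer_singleton_iff.1 (hle (Subgroup.mem_top g))

theorem IsAbelianSubgroup.inv_mul_mem_of_sup_eq_top {G : Type*} [Group G] {N H : Subgroup G}
    [N.Normal] (hH : IsAbelianSubgroup H) (htop : N ⊔ H = ⊤) (a b : G) :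
    (a * b)⁻¹ * (b * a) ∈ N := by
  have key (g : G) : ∃ h ∈ H, (QuotientGroup.mk g : G ⧸ N) = QuotientGroup.mk h := by
    obtain ⟨n, hn, h, hh, rfl⟩ :=
      Subgroup.mem_sup_of_normal_left.1 (htop ▸ Subgroup.mem_top g : g ∈ N ⊔ H)
    exact ⟨h, hh, by simp [(QuotientGroup.eq_one_iff n).2 hn]⟩
  obtain ⟨x, hx, hax⟩ := key a
  obtain ⟨y, hy, hby⟩ := key b
  rw [← QuotientGroup.eq, QuotientGroup.mk_mul, QuotientGroup.mk_mul, hax, hby,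
    ← QuotientGroup.mk_mul, ← QuotientGroup.mk_mul, hH x hx y hy]

/-- Lemma 2.2(b): if `H` is abelian then `C_H(N) = Z(G) ∩ H`; moreover the
class size of `g·C_H(N)` in `G/C_H(N)` equals the class size of `g` in `G`,
and `vcs(G/C_H(N)) ⊆ vcs(G)`. -/
theorem statement5 (G : Type) [Group G] [Finite G] (π : Set ℕ)
    (N H : Subgroup G) (hN : N.Normal) (hNhall : IsHallSubgroup π N)
    (hHhall : IsHallSubgroup πᶜ H) (hab : IsAbelianSubgroup H) :
    Subgroup.centralizer (N : Set G) ⊓ H = Subgroup.center G ⊓ H ∧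
    ∀ _hn : (Subgroup.centralizer (N : Set G) ⊓ H).Normal,
      (∀ g : G,
        classSize (QuotientGroup.mk g : G ⧸ (Subgroup.centralizer (N : Set G) ⊓ H))
          = classSize g) ∧
      vcs (G ⧸ (Subgroup.centralizer (N : Set G) ⊓ H)) ⊆ vcs G := by
  have hc := hNhall.isCompl hHhall
  refine ⟨hab.centralizer_inf_eq hc.sup_eq_top, fun hn => ?_⟩
  have hsurj := QuotientGroup.mk'_surjective (Subgroup.centralizer (N : Set G) ⊓ H)
  have hcs := classSize_map_of_surjective _ hsurj fun a b h => by
    have h₁ := hab.inv_mul_mem_of_sup_eq_top hc.sup_eq_top a b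
    exact inv_mul_eq_one.1 (Subgroup.disjoint_def.1 hc.disjoint h₁ (QuotientGroup.eq.1 h).2)
  exact ⟨hcs, vcs_subset_of_surjective _ hsurj hcs⟩
end
end

section
/- Let G be a finite group, π a set of primes, N a normal Hall π-subgroup of G, and H a π-complement of G. If ν is an irreducible complex character of N that vanishes on an element x ∈ C_N(H) (i.e., ν(x) = 0), then x is a vanishing element of G. -/
open scoped Classical

noncomputable section

universe u v

theorem Subgroup.sup_eq_top_of_isHallSubgroup {G : Type*} [Group G] {π : Set ℕ} {N H : Subgroup G}
    (hN : IsHallSubgroup π N) (hH : IsHallSubgroup πᶜ H) : N ⊔ H = ⊤ := by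
  rw [← Subgroup.index_eq_one]
  by_contra h
  obtain ⟨p, hp, hdvd⟩ := Nat.exists_prime_and_dvd h
  exact hH.2 p hp (hdvd.trans (Subgroup.index_dvd_of_le le_sup_right))
    (hN.2 p hp (hdvd.trans (Subgroup.index_dvd_of_le le_sup_left)))

/-- An atom in the lattice of subrepresentations is irreducible. -/
theorem Subrepresentation.isIrreducible_of_isAtom {k G V : Type*} [Field k] [Group G]
    [AddCommGroup V] [Module k V] {ρ : Representation k G V} {σ : Subrepresentation ρ}
    (hσ : IsAtom σ) : σ.toRepresentation.IsIrreducible := by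
  have hne : ∃ v ∈ σ, v ≠ 0 := by
    by_contra! h
    exact hσ.1 (eq_bot_iff.mpr fun v hv ↦ h v hv)
  obtain ⟨v, hv, hv0⟩ := hne
  have : Nontrivial (Subrepresentation σ.toRepresentation) := by
    refine ⟨⊥, ⊤, fun h ↦ hv0 ?_⟩
    have hmem : (⟨v, hv⟩ : σ.toSubmodule) ∈ (⊥ : Subrepresentation σ.toRepresentation) := by
      rw [h]; trivial
    exact congrArg Subtype.val (show (⟨v, hv⟩ : σ.toSubmodule) = 0 from hmem)
  refine ⟨fun τ ↦ ?_⟩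
  let τ' : Subrepresentation ρ :=
    { toSubmodule := τ.toSubmodule.map σ.toSubmodule.subtype
      apply_mem_toSubmodule := by
        rintro g _ ⟨w, hw, rfl⟩
        exact ⟨σ.toRepresentation g w, τ.apply_mem_toSubmodule g hw, rfl⟩ }
  have hle : τ' ≤ σ := by
    rintro _ ⟨w, -, rfl⟩
    exact w.2
  rcases hσ.le_iff.mp hle with h | h
  · left
    refine eq_bot_iff.mpr fun w hw ↦ ?_
    have hmem : (w : V) ∈ τ' := ⟨w, hw, rfl⟩
    rw [h] at hmem
    exact Subtype.ext (show (w : V) = 0 from hmem)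
  · right
    refine eq_top_iff.mpr fun w _ ↦ ?_
    have hmem : (w : V) ∈ τ' := by rw [h]; exact w.2
    obtain ⟨u, hu, huw⟩ := hmem
    rwa [← Subtype.ext huw]

theorem FDRep.isIrreducible_of_simple {k : Type u} {G : Type v} [Field k] [Group G]
    (W : FDRep k G) [CategoryTheory.Simple W] : Representation.IsIrreducible W.ρ := by
  have : Nontrivial (Subrepresentation W.ρ) := by
    refine ⟨⊥, ⊤, fun h ↦ CategoryTheory.id_nonzero W ?_⟩
    ext v
    have hmem : v ∈ (⊥ : Subrepresentation W.ρ) := by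
      rw [h]; trivial
    exact hmem
  refine ⟨fun U ↦ ?_⟩
  let i : FDRep.of U.toRepresentation ⟶ W :=
    FDRep.forget₂HomLinearEquiv _ _ (Rep.ofHom ⟨U.toSubmodule.subtype, fun g ↦ rfl⟩)
  have hi : Function.Injective i := Subtype.val_injective
  have : CategoryTheory.Mono i := CategoryTheory.ConcreteCategory.mono_of_injective i hi
  by_cases h : i = 0
  · left
    refine eq_bot_iff.mpr fun v hv ↦ ?_
    exact congr($h ⟨v, hv⟩)
  · right
    have := CategoryTheory.isIso_of_mono_of_nonzero h
    refine eq_top_iff.mpr fun v _ ↦ ?_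
    obtain ⟨u, rfl⟩ := (FDRep.isoToLinearEquiv (CategoryTheory.asIso i)).surjective v
    exact u.2

theorem FDRep.simple_of_isIrreducible {k G : Type u} [Field k] [IsAlgClosed k]
    [CharZero k] [Group G] [Finite G] {V : Type u} [AddCommGroup V] [Module k V]
    [FiniteDimensional k V] (ρ : Representation k G V) [ρ.IsIrreducible] :
    CategoryTheory.Simple (FDRep.of ρ) := by
  have := Fintype.ofFinite G
  have hcard : (Nat.card G : k) ≠ 0 := Nat.cast_ne_zero.mpr Nat.card_pos.ne'
  have := invertibleOfNonzero hcard
  rw [FDRep.simple_iff_char_is_norm_one]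
  have h := Representation.char_orthonormal ρ ρ
  rw [if_pos ⟨Representation.Equiv.refl ρ⟩, inv_mul_eq_one₀ hcard] at h
  exact h.symm

namespace Representation

variable {k G V W : Type*} [Field k] [Group G] [AddCommGroup V] [Module k V]
  [AddCommGroup W] [Module k W]

theorem nontrivial_coindV [Nontrivial W] (N : Subgroup G) (ρ : Representation k N W) :
    Nontrivial (coindV N.subtype ρ) := by
  obtain ⟨w, hw⟩ := exists_ne (0 : W)
  let f : G → W := fun g ↦ if h : g ∈ N then ρ ⟨g, h⟩ w else 0
  have hf : f ∈ coindV N.subtype ρ := by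
    intro n g
    by_cases hg : g ∈ N
    · have hng : (n : G) * g ∈ N := N.mul_mem n.2 hg
      simp only [f, Subgroup.subtype_apply, dif_pos hg, dif_pos hng]
      exact congr($(map_mul ρ n ⟨g, hg⟩) w)
    · have hng : (n : G) * g ∉ N := fun h ↦ hg ((N.mul_mem_cancel_left n.2).mp h)
      simp [f, hg, hng]
  refine ⟨⟨f, hf⟩, 0, fun h ↦ hw ?_⟩
  have h1 : f 1 = 0 := congr(($h).1 1)
  have h1' : f 1 = ρ 1 w := dif_pos N.one_mem
  simpa [h1] using h1'.symm

/-- Let `φ` be an equivariant map from a representation `τ` of a group to an irreducible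
representation `ρ` of a subgroup, such that no nonzero subrepresentation of `τ` lies in the kernel
of `φ`. Then `φ` maps some irreducible subrepresentation of `τ` onto `ρ`. -/
theorem exists_irreducible_subrepresentation_surjective [CharZero k] [Finite G] [Nontrivial V]
    (N : Subgroup G) (ρ : Representation k N W) [ρ.IsIrreducible] (τ : Representation k G V)
    (φ : V →ₗ[k] W) (hcomm : ∀ (n : N) (v : V), φ (τ n v) = ρ n (φ v))
    (hφ : ∀ v, v ≠ 0 → ∃ g, φ (τ g v) ≠ 0) :
    ∃ σ : Subrepresentation τ, σ.toRepresentation.IsIrreducible ∧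
      Function.Surjective (φ ∘ₗ σ.toSubmodule.subtype) := by
  have : NeZero (Nat.card G : k) := ⟨Nat.cast_ne_zero.mpr Nat.card_pos.ne'⟩
  have : IsSemisimpleModule (MonoidAlgebra k G) τ.asModule :=
    (isSemisimpleRepresentation_iff_isSemisimpleModule_asModule τ).mp inferInstance
  have : IsAtomic (Subrepresentation τ) :=
    Subrepresentation.subrepresentationSubmoduleOrderIso.isAtomic_iff.mpr inferInstance
  have hbot : (⊤ : Subrepresentation τ) ≠ ⊥ := by
    intro h
    obtain ⟨v, hv⟩ := exists_ne (0 : V)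
    have hmem : v ∈ (⊥ : Subrepresentation τ) := by
      rw [← h]; trivial
    exact hv hmem
  obtain ⟨σ, hσ, -⟩ := (IsAtomic.eq_bot_or_exists_atom_le _).resolve_left hbot
  refine ⟨σ, Subrepresentation.isIrreducible_of_isAtom hσ, ?_⟩
  let U : Subrepresentation ρ :=
    { toSubmodule := LinearMap.range (φ ∘ₗ σ.toSubmodule.subtype)
      apply_mem_toSubmodule := by
        rintro n _ ⟨v, rfl⟩
        exact ⟨⟨τ n v, σ.apply_mem_toSubmodule n v.2⟩, hcomm n v⟩ }
  rcases eq_bot_or_eq_top U with h | h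
  · exfalso
    refine hσ.1 (eq_bot_iff.mpr fun v hv ↦ ?_)
    by_contra hv0
    obtain ⟨g, hg⟩ := hφ v hv0
    have hmem : φ (τ g v) ∈ U := ⟨⟨τ g v, σ.apply_mem_toSubmodule g hv⟩, rfl⟩
    rw [h] at hmem
    exact hg hmem
  · exact LinearMap.range_eq_top.mp congr(($h).toSubmodule)

/-- If the nonzero representation `ρ` of a subgroup is a quotient of the restriction of the
irreducible representation `σ`, then `σ` has trace zero at every element all of whose conjugates
lie in the subgroup and have trace zero under `ρ`. -/
theorem character_eq_zero_of_surjective_restrict [CharZero k] [IsAlgClosed k] [Finite G]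
    [FiniteDimensional k V] [FiniteDimensional k W]
    (N : Subgroup G) (ρ : Representation k N W) (σ : Representation k G V) [σ.IsIrreducible]
    [Nontrivial W] (φ : V →ₗ[k] W) (hφ : Function.Surjective φ)
    (hcomm : ∀ (n : N) (v : V), φ (σ n v) = ρ n (φ v)) (x : G)
    (hx : ∀ g : G, ∃ h : g⁻¹ * x * g ∈ N, ρ.character ⟨_, h⟩ = 0) : σ.character x = 0 := by
  have := Fintype.ofFinite G
  obtain ⟨θ, hθ⟩ := φ.exists_rightInverse_of_surjective (LinearMap.range_eq_top.mpr hφ)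
  set P : V →ₗ[k] V := θ ∘ₗ φ with hP
  set A : V →ₗ[k] V := ∑ g : G, σ g * P * σ g⁻¹ with hA
  have hAσ (g : G) : A * σ g = σ g * A := by
    rw [hA, Finset.sum_mul, Finset.mul_sum]
    refine Fintype.sum_bijective (g⁻¹ * ·) (Group.mulLeft_bijective g⁻¹) _ _ fun a ↦ ?_
    simp only [mul_assoc, ← map_mul, mul_inv_rev, inv_inv]
    rw [← mul_assoc (σ g), ← map_mul, mul_inv_cancel_left]
  obtain ⟨c, hc⟩ := (IsIrreducible.algebraMap_intertwiningMap_bijective_of_isAlgClosed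
    (ρ := σ)).2 ⟨A, hAσ⟩
  have hcA : A = c • LinearMap.id := by
    ext v
    exact congr($hc v).symm
  have hc0 : c ≠ 0 := by
    rintro rfl
    have htr : LinearMap.trace k V A = Nat.card G * Module.finrank k W := by
      have (g : G) : LinearMap.trace k V (σ g * P * σ g⁻¹) = Module.finrank k W := by
        rw [LinearMap.trace_mul_comm, ← mul_assoc, ← map_mul, inv_mul_cancel, map_one, one_mul,
          hP, LinearMap.trace_comp_comm', hθ, LinearMap.trace_id]
      simp [hA, this]
    rw [hcA, zero_smul, map_zero, eq_comm, mul_eq_zero] at htr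
    rcases htr with h | h
    · exact Nat.card_pos.ne' (Nat.cast_eq_zero.mp h)
    · exact Module.finrank_pos.ne' (Nat.cast_eq_zero.mp h)
  have hxA : LinearMap.trace k V (σ x * A) = 0 := by
    rw [hA, Finset.mul_sum, map_sum]
    refine Finset.sum_eq_zero fun g _ ↦ ?_
    obtain ⟨hg, h0⟩ := hx g
    calc LinearMap.trace k V (σ x * (σ g * P * σ g⁻¹))
        = LinearMap.trace k V (σ (g⁻¹ * x * g) * P) := by
          rw [← mul_assoc, LinearMap.trace_mul_comm]
          simp [mul_assoc]
      _ = LinearMap.trace k W (φ ∘ₗ σ (g⁻¹ * x * g) ∘ₗ θ) := by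
          rw [hP, ← LinearMap.trace_comp_comm']
          rfl
      _ = LinearMap.trace k W (ρ ⟨_, hg⟩) := by
          congr 1
          ext w
          exact (hcomm ⟨_, hg⟩ (θ w)).trans congr(ρ ⟨_, hg⟩ ($hθ w))
      _ = 0 := h0
  have : σ x * A = c • σ x := by
    rw [hcA]
    ext v
    simp
  rw [this, map_smul, smul_eq_mul] at hxA
  exact (mul_eq_zero.mp hxA).resolve_left hc0

end Representation

/-- Lemma 2.2(c): if an irreducible character `ν` of `N` vanishes on
`x ∈ C_N(H)`, then `x` is a vanishing element of `G`. -/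
theorem statement6 (G : Type) [Group G] [Finite G] (π : Set ℕ)
    (N H : Subgroup G) (hN : N.Normal) (hNhall : IsHallSubgroup π N)
    (hHhall : IsHallSubgroup πᶜ H)
    (ν : FDRep ℂ ↥N) (hν : CategoryTheory.Simple ν)
    (x : G) (hx : x ∈ N) (hxC : x ∈ Subgroup.centralizer (H : Set G))
    (hzero : ν.character ⟨x, hx⟩ = 0) :
    IsVanishing G x := by
  have htop := Subgroup.sup_eq_top_of_isHallSubgroup hNhall hHhall
  have := ν.isIrreducible_of_simple
  have : Nontrivial ν := by
    by_contra h
    rw [not_nontrivial_iff_subsingleton] at h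
    refine CategoryTheory.id_nonzero ν ?_
    ext v
    exact Subsingleton.elim _ _
  let τ : Representation ℂ G (Representation.coindV N.subtype ν.ρ) :=
    Representation.coind N.subtype ν.ρ
  let φ : Representation.coindV N.subtype ν.ρ →ₗ[ℂ] ν :=
    LinearMap.proj 1 ∘ₗ Submodule.subtype _
  have hφτ (g : G) (f) : φ (τ g f) = f.1 g := congrArg f.1 (one_mul g)
  have hcomm (n : N) (f) : φ (τ n f) = ν.ρ n (φ f) := by
    have := f.2 n 1
    rw [mul_one] at this
    exact (hφτ n f).trans this
  have hτ (f) (hf : f ≠ 0) : ∃ g, φ (τ g f) ≠ 0 := by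
    by_contra! h
    refine hf (Subtype.ext (funext fun g ↦ ?_))
    exact (hφτ g f).symm.trans (h g)
  have := Representation.nontrivial_coindV N ν.ρ
  obtain ⟨σ, hσ, hsurj⟩ := Representation.exists_irreducible_subrepresentation_surjective
    N ν.ρ τ φ hcomm hτ
  refine ⟨FDRep.of (V := σ.toSubmodule) σ.toRepresentation, FDRep.simple_of_isIrreducible _, ?_⟩
  refine Representation.character_eq_zero_of_surjective_restrict (V := σ.toSubmodule) N ν.ρ
    σ.toRepresentation (φ ∘ₗ σ.toSubmodule.subtype) hsurj (by exact fun n v ↦ hcomm n v) x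
    fun g ↦ ?_
  obtain ⟨h, hh, n, hn, rfl⟩ : ∃ h ∈ H, ∃ n ∈ N, h * n = g :=
    Subgroup.mem_sup_of_normal_right.mp (by rw [sup_comm, htop]; trivial)
  have hconj : (h * n)⁻¹ * x * (h * n) = n⁻¹ * x * n := by
    have hcomm := Subgroup.mem_centralizer_iff.mp hxC h hh
    rw [mul_inv_rev, mul_assoc, mul_assoc, ← mul_assoc x, ← hcomm]
    simp [mul_assoc]
  refine ⟨hconj ▸ N.mul_mem (N.mul_mem (N.inv_mem hn) hx) hn, ?_⟩
  have := ν.char_conj ⟨x, hx⟩ ⟨n, hn⟩⁻¹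
  rw [hzero] at this
  convert! this using 2
  exact Subtype.ext (by simpa using hconj)
end
end

section
/- Let G be a finite group, π a set of primes, N a normal Hall π-subgroup of G, and H a π-complement of G; assume H is abelian and C_H(N) < H. Suppose that C_N(h) = C_N(H) for all h ∈ H \ C_H(N), that C_N(H) is abelian, and that C_N(H) is normal in N. Then G/Z(G) is a Frobenius group with Frobenius kernel NZ(G)/Z(G). -/
open scoped Classical

noncomputable section

/-- Suppose `h ^ m = h` and `m` kills every element of `C_N(h)`. Then every element of the coset
`N h` is an `N`-conjugate of `h * c` for some `c ∈ C_N(h)`. -/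
theorem exists_conj_of_mem_coset {G : Type*} [Group G] [Finite G] {N : Subgroup G}
    (hN : N.Normal) {h : G} {m : ℕ} (hm : h ^ m = h)
    (hC : ∀ c ∈ N, h * c = c * h → c ^ m = 1) {n : G} (hn : n ∈ N) :
    ∃ g ∈ N, ∃ c ∈ N, h * c = c * h ∧ n * h = g * (h * c) * g⁻¹ := by
  let C : Subgroup N := (Subgroup.centralizer {h}).subgroupOf N
  have memC : ∀ c : N, c ∈ C ↔ h * (c : G) = c * h := by
    intro c
    simp only [C, Subgroup.mem_subgroupOf, Subgroup.mem_centralizer_iff, Set.mem_singleton_iff,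
      forall_eq]
  let f : (N ⧸ C) × C → N := fun q =>
    ⟨(q.1.out : G) * (h * (q.2 : N)) * (q.1.out : G)⁻¹ * h⁻¹, by
      have h1 : h * ((q.2 : N) : G) * (q.1.out : G)⁻¹ * h⁻¹ ∈ N := by
        have := hN.conj_mem _ (N.mul_mem (q.2 : N).2 (N.inv_mem q.1.out.2)) h
        simpa [mul_assoc] using this
      simpa [mul_assoc] using N.mul_mem q.1.out.2 h1⟩
  have key : ∀ (g : G) (c : C), (g * (h * (c : N)) * g⁻¹) ^ m = g * h * g⁻¹ := by
    intro g c
    have hc := (memC c).1 c.2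
    rw [conj_pow, (show Commute h ((c : N) : G) from hc).mul_pow, hm, hC _ (c : N).2 hc, mul_one]
  have finj : Function.Injective f := by
    rintro ⟨q, c⟩ ⟨q', c'⟩ hqq
    have h0 : (q.out : G) * (h * (c : N)) * (q.out : G)⁻¹
        = (q'.out : G) * (h * (c' : N)) * (q'.out : G)⁻¹ :=
      mul_right_cancel (congrArg Subtype.val hqq)
    have h1 := congrArg (· ^ m) h0
    simp only [key] at h1
    have hq : q = q' := by
      rw [← QuotientGroup.out_eq' q, ← QuotientGroup.out_eq' q', QuotientGroup.eq, memC]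
      push_cast
      have h2 : h = (q.out : G)⁻¹ * ((q'.out : G) * h * (q'.out : G)⁻¹) * q.out := by
        rw [← h1]; group
      calc h * ((q.out : G)⁻¹ * q'.out)
          = ((q.out : G)⁻¹ * ((q'.out : G) * h * (q'.out : G)⁻¹) * q.out)
              * ((q.out : G)⁻¹ * q'.out) := by rw [← h2]
        _ = (q.out : G)⁻¹ * q'.out * h := by group
    subst hq
    have h3 : ((c : N) : G) = (c' : N) := mul_left_cancel (mul_left_cancel (mul_right_cancel h0))
    rw [Subtype.ext (Subtype.ext h3)]
  have fsurj : Function.Surjective f :=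
    ((Nat.bijective_iff_injective_and_card f).2 ⟨finj, by
      rw [Nat.card_prod, ← Subgroup.card_eq_card_quotient_mul_card_subgroup]⟩).2
  obtain ⟨⟨q, c⟩, hqc⟩ := fsurj ⟨n, hn⟩
  refine ⟨q.out, q.out.2, (c : N), (c : N).2, (memC c).1 c.2, ?_⟩
  have := congrArg Subtype.val hqc
  simp only [f] at this
  rw [← this, inv_mul_cancel_right]

/-- A normal Hall subgroup and a Hall subgroup for the complementary set of primes have coprime
orders and are complements of each other. -/
theorem IsHallSubgroup.coprime_and_isComplement' {G : Type*} [Group G] [Finite G] {π : Set ℕ}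
    {N H : Subgroup G} (hN : IsHallSubgroup π N) (hH : IsHallSubgroup πᶜ H) :
    (Nat.card N).Coprime (Nat.card H) ∧ N.IsComplement' H := by
  have hco : (Nat.card N).Coprime (Nat.card H) :=
    Nat.Coprime.symm <| Nat.coprime_of_dvd fun p hp h1 h2 => hH.1 p hp h1 (hN.1 p hp h2)
  have hco' : N.index.Coprime H.index :=
    Nat.coprime_of_dvd fun p hp h1 h2 => hH.2 p hp h2 (hN.2 p hp h1)
  have e : Nat.card N * N.index = Nat.card H * H.index := by
    rw [N.card_mul_index, H.card_mul_index]
  have hidx : Nat.card H = N.index :=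
    Nat.dvd_antisymm (hco.symm.dvd_of_dvd_mul_left (e ▸ dvd_mul_right _ _))
      (hco'.dvd_of_dvd_mul_right (e ▸ dvd_mul_left _ _))
  refine ⟨hco, Subgroup.isComplement'_of_coprime ?_ hco⟩
  rw [hidx, N.card_mul_index]

/-- Corollary 2.5(b): with `H` abelian, `C_H(N) < H`, `C_N(h) = C_N(H)` for all
`h ∈ H \ C_H(N)`, `C_N(H)` abelian and normal in `N`, the quotient `G/Z(G)` is
a Frobenius group with kernel `NZ(G)/Z(G)`. -/
theorem statement9 (G : Type) [Group G] [Finite G] (π : Set ℕ)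
    (N H : Subgroup G) (hN : N.Normal) (hNhall : IsHallSubgroup π N)
    (hHhall : IsHallSubgroup πᶜ H) (hab : IsAbelianSubgroup H)
    (hlt : Subgroup.centralizer (N : Set G) ⊓ H < H)
    (hcent : ∀ h ∈ H, h ∉ Subgroup.centralizer (N : Set G) →
      Subgroup.centralizer {h} ⊓ N = Subgroup.centralizer (H : Set G) ⊓ N)
    (habC : IsAbelianSubgroup (Subgroup.centralizer (H : Set G) ⊓ N))
    (hnorm : ((Subgroup.centralizer (H : Set G) ⊓ N).subgroupOf N).Normal) :
    IsFrobeniusWithKernel (N.map (QuotientGroup.mk' (Subgroup.center G))) := by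
  obtain ⟨hco, hcompl⟩ := hNhall.coprime_and_isComplement' hHhall
  have fact : ∀ x : G, ∃ n ∈ N, ∃ h ∈ H, n * h = x := by
    intro x
    obtain ⟨⟨n, h⟩, hx⟩ := hcompl.2 x
    exact ⟨n, n.2, h, h.2, hx⟩
  obtain ⟨m, hm0, hm1⟩ := Nat.chineseRemainder hco 0 1
  have powN : ∀ n ∈ N, n ^ m = 1 := by
    intro n hn
    rw [← orderOf_dvd_iff_pow_eq_one]
    exact (Subgroup.orderOf_dvd_natCard N hn).trans ((Nat.modEq_zero_iff_dvd).1 hm0)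
  have powH : ∀ h ∈ H, h ^ m = h := by
    intro h hh
    conv_rhs => rw [← pow_one h]
    rw [pow_eq_pow_iff_modEq]
    exact hm1.of_dvd (Subgroup.orderOf_dvd_natCard H hh)
  have memC : ∀ h ∈ H, h ∉ Subgroup.centralizer (N : Set G) → ∀ c ∈ N, h * c = c * h →
      c ∈ Subgroup.centralizer (H : Set G) ⊓ N := by
    intro h hh hhN c hc hcc
    rw [← hcent h hh hhN]
    refine ⟨Subgroup.mem_centralizer_iff.2 ?_, hc⟩
    rintro _ rfl
    exact hcc
  have coset : ∀ h ∈ H, h ∉ Subgroup.centralizer (N : Set G) → ∀ n ∈ N,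
      ∃ g ∈ N, ∃ c ∈ Subgroup.centralizer (H : Set G) ⊓ N, n * h = g * (h * c) * g⁻¹ := by
    intro h hh hhN n hn
    obtain ⟨g, hg, c, hc, hcc, e⟩ :=
      exists_conj_of_mem_coset hN (powH h hh) (fun c hc _ => powN c hc) hn
    exact ⟨g, hg, c, memC h hh hhN c hc hcc, e⟩
  have central_of : ∀ z : G, (∀ n ∈ N, n * z = z * n) → (∀ h ∈ H, h * z = z * h) →
      z ∈ Subgroup.center G := by
    intro z h1 h2
    rw [Subgroup.mem_center_iff]
    intro x
    obtain ⟨n, hn, h, hh, rfl⟩ := fact x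
    exact ((show Commute n z from h1 n hn).mul_left (show Commute h z from h2 h hh))
  have centralH : ∀ h ∈ H, h ∈ Subgroup.centralizer (N : Set G) → h ∈ Subgroup.center G :=
    fun h hh hhN => central_of h (Subgroup.mem_centralizer_iff.1 hhN) fun h' hh' => hab _ hh' _ hh
  obtain ⟨h₀, hh₀, hh₀N⟩ : ∃ h ∈ H, h ∉ Subgroup.centralizer (N : Set G) := by
    obtain ⟨h, hh, hh'⟩ := SetLike.exists_of_lt hlt
    exact ⟨h, hh, fun h1 => hh' ⟨h1, hh⟩⟩
  have centralC : ∀ c ∈ Subgroup.centralizer (H : Set G) ⊓ N, c ∈ Subgroup.center G := by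
    intro c hc
    have hcH := Subgroup.mem_centralizer_iff.1 hc.1
    refine central_of c ?_ hcH
    intro n hn
    obtain ⟨g, hg, d, hd, e⟩ := coset h₀ hh₀ hh₀N n hn
    have hcg : g⁻¹ * c * g ∈ Subgroup.centralizer (H : Set G) ⊓ N := by
      have := hnorm.conj_mem ⟨c, hc.2⟩ (Subgroup.mem_subgroupOf.2 hc) ⟨g⁻¹, N.inv_mem hg⟩
      refine ⟨by simpa [Subgroup.mem_subgroupOf] using this, ?_⟩
      exact N.mul_mem (N.mul_mem (N.inv_mem hg) hc.2) hg
    have h1 : Commute (h₀ * d) (g⁻¹ * c * g) :=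
      Commute.mul_left (Subgroup.mem_centralizer_iff.1 hcg.1 h₀ hh₀) (habC d hd _ hcg)
    have h2 : Commute (n * h₀) c := by
      rw [e]
      have h3 := h1.map (MulAut.conj g)
      simp only [MulAut.conj_apply] at h3
      rwa [show g * (g⁻¹ * c * g) * g⁻¹ = c by group] at h3
    have h4 : Commute (n * h₀ * h₀⁻¹) c :=
      h2.mul_left (show Commute h₀ c from hcH h₀ hh₀).inv_left
    rwa [mul_inv_cancel_right] at h4
  have center_fact : ∀ n ∈ N, ∀ h ∈ H, n * h ∈ Subgroup.center G → h ∈ Subgroup.center G := by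
    intro n hn h hh hz
    have h1 : n * (n * h) = (n * h) * n := Subgroup.mem_center_iff.1 hz n
    have h2 : Commute n h := mul_left_cancel (h1.trans (mul_assoc _ _ _))
    have h3 := (Subgroup.center G).pow_mem hz m
    rwa [h2.mul_pow, powN n hn, powH h hh, one_mul] at h3
  have not_central : h₀ ∉ Subgroup.center G := fun h1 =>
    hh₀N (Subgroup.center_le_centralizer _ h1)
  refine ⟨?_, ?_, hN.map _ (QuotientGroup.mk'_surjective _), ?_⟩
  · intro hbot
    rw [Subgroup.map_eq_bot_iff, QuotientGroup.ker_mk'] at hbot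
    refine hh₀N (Subgroup.mem_centralizer_iff.2 fun n hn => ?_)
    exact (Subgroup.mem_center_iff.1 (hbot hn) h₀).symm
  · intro htop
    have h1 : QuotientGroup.mk' (Subgroup.center G) h₀ ∈
        N.map (QuotientGroup.mk' (Subgroup.center G)) := htop ▸ Subgroup.mem_top _
    obtain ⟨n, hn, e⟩ := h1
    have h2 : n⁻¹ * h₀ ∈ Subgroup.center G := QuotientGroup.eq.1 e
    exact not_central (center_fact _ (N.inv_mem hn) _ hh₀ h2)
  · rintro _ ⟨k, hk, rfl⟩ hk1 y hy
    obtain ⟨x, rfl⟩ := QuotientGroup.mk'_surjective _ y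
    obtain ⟨n, hn, h, hh, rfl⟩ := fact x
    by_cases hhN : h ∈ Subgroup.centralizer (N : Set G)
    · refine ⟨n, hn, QuotientGroup.eq.2 ?_⟩
      rw [inv_mul_cancel_left]
      exact centralH h hh hhN
    · exfalso
      apply hk1
      obtain ⟨g, hg, c, hc, e⟩ := coset h hh hhN n hn
      have hcZ := centralC c hc
      have hbar : QuotientGroup.mk' (Subgroup.center G) (n * h)
          = QuotientGroup.mk' (Subgroup.center G) (g * h * g⁻¹) := by
        refine (QuotientGroup.eq.2 ?_).symm
        rw [e, show (g * h * g⁻¹)⁻¹ * (g * (h * c) * g⁻¹) = g * c * g⁻¹ by group]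
        exact (inferInstance : (Subgroup.center G).Normal).conj_mem c hcZ g
      have hcomm := Subgroup.mem_centralizer_iff.1 hy _ rfl
      rw [hbar, ← map_mul, ← map_mul] at hcomm
      have hz := QuotientGroup.eq.1 hcomm
      set l := g⁻¹ * k * g with hl
      have hlN : l ∈ N := by
        have := hN.conj_mem k hk g⁻¹
        rwa [inv_inv] at this
      have hz' : (l * h)⁻¹ * (h * l) ∈ Subgroup.center G := by
        have := (inferInstance : (Subgroup.center G).Normal).conj_mem _ hz g⁻¹
        rw [hl]
        convert this using 1
        group
      set z := (l * h)⁻¹ * (h * l) with hzdef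
      have hzN : z ∈ N := by
        have h1 := N.mul_mem (hN.conj_mem _ (N.inv_mem hlN) h⁻¹) hlN
        convert h1 using 1
        rw [hzdef]
        group
      have h1 : l⁻¹ * h * l = h * z := by
        have h2 : h * l = l * h * z := by rw [hzdef, mul_inv_cancel_left]
        rw [mul_assoc, h2]
        group
      have h3 : l⁻¹ * h * l = h := by
        have h4 := congrArg (· ^ m) h1
        have h5 : (l⁻¹ * h * l) ^ m = l⁻¹ * h ^ m * l := by
          simpa using conj_pow (i := m) (a := l⁻¹) (b := h)
        have h6 : Commute h z := Subgroup.mem_center_iff.1 hz' h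
        simp only [h5, h6.mul_pow, powH h hh, powN z hzN, mul_one] at h4
        exact h4
      have hlC : l ∈ Subgroup.center G := by
        refine centralC l (memC h hh hhN l hlN ?_)
        rw [mul_assoc, inv_mul_eq_iff_eq_mul] at h3
        exact h3
      have hkZ : k ∈ Subgroup.center G := by
        have := (inferInstance : (Subgroup.center G).Normal).conj_mem _ hlC g
        rwa [hl, show g * (g⁻¹ * k * g) * g⁻¹ = k by group] at this
      exact (QuotientGroup.eq_one_iff k).2 hkZ
end
end

section
/- Let G be a finite group, π a set of primes, N a nilpotent normal Hall π-subgroup of G, and H a π-complement of G with C_H(N) < H. If θ is a nonlinear irreducible complex character of N (i.e., θ(1) > 1), then θ vanishes on some element of N that is not conjugate in N to any element of C_N(H). -/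
open scoped Classical

noncomputable section

theorem Subgroup.exists_notMem_of_ne_top {G : Type*} [Group G] {A B : Subgroup G}
    (hA : A ≠ ⊤) (hB : B ≠ ⊤) : ∃ x, x ∉ A ∧ x ∉ B := by
  obtain ⟨a, ha⟩ : ∃ a, a ∉ A := by simpa [Subgroup.eq_top_iff'] using hA
  obtain ⟨b, hb⟩ : ∃ b, b ∉ B := by simpa [Subgroup.eq_top_iff'] using hB
  by_cases haB : a ∈ B
  · by_cases hbA : b ∈ A
    · exact ⟨a * b, fun h => ha ((A.mul_mem_cancel_right hbA).1 h),
        fun h => hb ((B.mul_mem_cancel_left haB).1 h)⟩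
    · exact ⟨b, hbA, hb⟩
  · exact ⟨a, ha, haB⟩

/-- In a nilpotent group, a set that contains `1` but is not everything fails to contain
some element that is central modulo it. -/
theorem Group.IsNilpotent.exists_notMem_forall_commutator_mem {G : Type*} [Group G]
    [Group.IsNilpotent G] {S : Set G} (h_one : 1 ∈ S) (hS : S ≠ Set.univ) :
    ∃ g ∉ S, ∀ x, g * x * g⁻¹ * x⁻¹ ∈ S := by
  have hex : ∃ n, ¬ (Subgroup.upperCentralSeries G n : Set G) ⊆ S := by
    obtain ⟨n, hn⟩ := Group.IsNilpotent.nilpotent G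
    exact ⟨n, fun h => hS (Set.univ_subset_iff.1 (by simpa [hn] using h))⟩
  obtain ⟨n, hn, hmin⟩ : ∃ n, (Subgroup.upperCentralSeries G n : Set G) ⊆ S ∧
      ¬ (Subgroup.upperCentralSeries G (n + 1) : Set G) ⊆ S := by
    by_contra! h
    obtain ⟨m, hm⟩ := hex
    refine hm (Nat.rec ?_ (fun k hk => h k hk) m)
    simpa using h_one
  obtain ⟨g, hg, hgS⟩ := Set.not_subset.1 hmin
  exact ⟨g, hgS, fun x => hn (Subgroup.mem_upperCentralSeries_succ_iff.1 hg x)⟩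

/-- Every conjugate of a proper subgroup of a finite nilpotent group lies in a common
proper subgroup. -/
theorem Group.IsNilpotent.exists_normal_ne_top_ge {G : Type*} [Group G] [Finite G]
    [Group.IsNilpotent G] {C : Subgroup G} (hC : C ≠ ⊤) :
    ∃ M : Subgroup G, M.Normal ∧ M ≠ ⊤ ∧ C ≤ M := by
  obtain ⟨M, hM, hCM⟩ := (eq_top_or_exists_le_coatom C).resolve_left hC
  exact ⟨M, Subgroup.NormalizerCondition.normal_of_coatom M
    Group.normalizerCondition_of_isNilpotent hM, hM.1, hCM⟩

namespace FDRep

variable {k G : Type} [Field k] [IsAlgClosed k]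

open CategoryTheory Module

/-- **Schur's lemma** for linear maps commuting with a simple representation. -/
theorem exists_eq_smul_one_of_commute [Monoid G] (V : FDRep k G) [Simple V]
    (A : V →ₗ[k] V) (hA : ∀ g, Commute A (V.ρ g)) : ∃ c : k, A = c • 1 := by
  let f : V ⟶ V := ⟨FGModuleCat.ofHom A, fun g => by
    ext v
    exact LinearMap.congr_fun (hA g).eq v⟩
  obtain ⟨c, hc⟩ := endomorphism_simple_eq_smul_id k f
  refine ⟨c, ?_⟩
  have h : f.hom.hom.hom = (c • 𝟙 V : V ⟶ V).hom.hom.hom := by rw [hc]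
  exact h

theorem finrank_eq_one_of_forall_scalar [Monoid G] (V : FDRep k G) [Simple V]
    (h : ∀ g, ∃ c : k, V.ρ g = c • 1) : finrank k V = 1 := by
  have hle : finrank k (V →ₗ[k] V) ≤ 1 := finrank_le_one 1 fun A => by
    obtain ⟨c, hc⟩ := V.exists_eq_smul_one_of_commute A fun g => by
      obtain ⟨c, hc⟩ := h g
      rw [hc]
      exact (Commute.one_right A).smul_right c
    exact ⟨c, hc.symm⟩
  have hne : finrank k V ≠ 0 := fun h0 => by
    have : Subsingleton V := finrank_zero_iff.1 h0
    refine id_nonzero V ?_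
    ext v
    exact Subsingleton.elim (α := V) _ _
  rw [finrank_linearMap] at hle
  nlinarith [Nat.pos_of_ne_zero hne]

/-- A nonlinear irreducible character of a nilpotent group vanishes off a proper subgroup. -/
theorem exists_subgroup_forall_notMem_character_eq_zero [Group G] [Group.IsNilpotent G]
    (V : FDRep k G) [Simple V] (hV : V.character 1 ≠ 1) :
    ∃ K : Subgroup G, K ≠ ⊤ ∧ ∀ x ∉ K, V.character x = 0 := by
  have hS : {g : G | ∃ c : k, V.ρ g = c • 1} ≠ Set.univ := fun h => hV <| by
    rw [char_one, V.finrank_eq_one_of_forall_scalar (Set.eq_univ_iff_forall.1 h), Nat.cast_one]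
  obtain ⟨g, hg, hgx⟩ := Group.IsNilpotent.exists_notMem_forall_commutator_mem
    (S := {g : G | ∃ c : k, V.ρ g = c • 1}) ⟨1, by simp⟩ hS
  refine ⟨(Subgroup.centralizer {V.ρ.toHomUnits g}).comap V.ρ.toHomUnits, fun hK => hg ?_,
    fun x hx => ?_⟩
  · refine V.exists_eq_smul_one_of_commute _ fun x => ?_
    have hx : x ∈ (Subgroup.centralizer {V.ρ.toHomUnits g}).comap V.ρ.toHomUnits :=
      hK ▸ Subgroup.mem_top x
    rw [Subgroup.mem_comap, Subgroup.mem_centralizer_singleton_iff] at hx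
    exact (congrArg Units.val hx).symm
  · obtain ⟨c, hc⟩ := hgx x
    have hconj : V.ρ (g * x * g⁻¹) = c • V.ρ x := by
      rw [← inv_mul_cancel_right (g * x * g⁻¹) x, map_mul, hc, smul_mul_assoc, one_mul]
    have hc1 : c ≠ 1 := by
      rintro rfl
      refine hx ?_
      rw [Subgroup.mem_comap, Subgroup.mem_centralizer_singleton_iff]
      ext1
      change V.ρ x * V.ρ g = V.ρ g * V.ρ x
      rw [one_smul] at hconj
      rw [← map_mul V.ρ g x, ← inv_mul_cancel_right (g * x) g, map_mul, hconj]
    have htr : V.character x = c * V.character x := by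
      conv_lhs => rw [← V.char_conj x g]
      simp only [character, hconj, map_smul, smul_eq_mul]
    exact (mul_eq_zero.1 (by linear_combination htr : (1 - c) * V.character x = 0)).resolve_left
      (sub_ne_zero.2 hc1.symm)

end FDRep

/-- Lemma 3.1: with `N` a nilpotent normal Hall `π`-subgroup, `H` a
`π`-complement with `C_H(N) < H`, every nonlinear irreducible character `θ` of
`N` vanishes on some element of `N` not conjugate in `N` to any element of
`C_N(H)`. -/
theorem statement10 (G : Type) [Group G] [Finite G] (π : Set ℕ)
    (N H : Subgroup G) (hN : N.Normal) (hNnil : Group.IsNilpotent ↥N)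
    (hNhall : IsHallSubgroup π N) (hHhall : IsHallSubgroup πᶜ H)
    (hlt : Subgroup.centralizer (N : Set G) ⊓ H < H)
    (θ : FDRep ℂ ↥N) (hθ : CategoryTheory.Simple θ)
    (hnl : θ.character 1 ≠ 1) :
    ∃ x : ↥N, θ.character x = 0 ∧
      ∀ n : ↥N, ((n⁻¹ * x * n : ↥N) : G) ∉ Subgroup.centralizer (H : Set G) := by
  have hC : (Subgroup.centralizer (H : Set G)).subgroupOf N ≠ ⊤ := fun h =>
    hlt.ne (inf_eq_right.2 (Subgroup.le_centralizer_iff.1 (Subgroup.subgroupOf_eq_top.1 h)))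
  obtain ⟨M, hMn, hM, hCM⟩ := Group.IsNilpotent.exists_normal_ne_top_ge hC
  obtain ⟨K, hK, hvan⟩ := θ.exists_subgroup_forall_notMem_character_eq_zero hnl
  obtain ⟨x, hxM, hxK⟩ := Subgroup.exists_notMem_of_ne_top hM hK
  refine ⟨x, hvan x hxK, fun n hn => hxM ?_⟩
  have hmem : n⁻¹ * x * n ∈ M := hCM (Subgroup.mem_subgroupOf.2 hn)
  simpa [mul_assoc] using hMn.conj_mem _ hmem n
end
end
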